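/- Let F be a field of characteristic p > 0, let b_1,…,b_r ∈ F and set E := F(b_1^{1/p},…,b_r^{1/p}). Then H_p^{n+1}(E/F) = Σ_{i=1}^r (image of db_i ∧ Ω_F^{n-1} in H_p^{n+1}(F)) = Σ_{i=1}^r (image of b_i·d(Ω_F^{n-1}) in H_p^{n+1}(F)). -/

import Mathlib

noncomputable section

/-- The full algebra of absolute differential forms of a field `F`:
the exterior algebra of the `F`-module of absolute Kähler differentials `Ω[F⁄ℤ]`. -/
abbrev DF (F : Type*) [Field F] : Type _ :=
  ExteriorAlgebra F (KaehlerDifferential ℤ F)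

/-- `Ω_F^n`, the space of differential `n`-forms, as a submodule of `DF F`. -/
def omegaPow (F : Type*) [Field F] (n : ℕ) : Submodule F (DF F) :=
  LinearMap.range (ExteriorAlgebra.ι F :
    KaehlerDifferential ℤ F →ₗ[F] DF F) ^ n

/-- `Ω_F^{n-1}`, with the convention `Ω_F^{-1} = 0`. -/
def omegaPred (F : Type*) [Field F] : ℕ → Submodule F (DF F)
  | 0 => ⊥
  | n + 1 => omegaPow F n

/-- The exact 1-form `d a` of an element `a ∈ F`. -/
def dForm (F : Type*) [Field F] (a : F) : DF F :=
  ExteriorAlgebra.ι F (KaehlerDifferential.D ℤ F a)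

/-- The logarithmic 1-form `da/a` of an element `a ∈ F`. -/
def dLog (F : Type*) [Field F] (a : F) : DF F :=
  ExteriorAlgebra.ι F (a⁻¹ • KaehlerDifferential.D ℤ F a)

/-- The logarithmic `n`-form `(dx₁/x₁) ∧ … ∧ (dxₙ/xₙ)`. -/
def logForm (F : Type*) [Field F] {n : ℕ} (x : Fin n → F) : DF F :=
  (List.ofFn fun i => dLog F (x i)).prod

/-- The exterior derivative `d` together with the (`p`-basis dependent) additive map `s_p`
on the differential forms of a field `F` of characteristic `p`. -/
structure DiffStr (p : ℕ) (F : Type*) [Field F] where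
  d : DF F →+ DF F
  sp : DF F →+ DF F
  d_grade : ∀ n : ℕ, ∀ ω ∈ omegaPow F n, d ω ∈ omegaPow F (n + 1)
  d_d : ∀ ω : DF F, d (d ω) = 0
  d_one : d 1 = 0
  d_smul : ∀ (a : F) (ω : DF F), d (a • ω) = dForm F a * ω + a • d ω
  sp_grade : ∀ n : ℕ, ∀ ω ∈ omegaPow F n, sp ω ∈ omegaPow F n
  sp_log : ∀ (n : ℕ) (a : F) (x : Fin n → F),
      ∃ η ∈ omegaPred F n, sp (a • logForm F x) = a ^ p • logForm F x + d η

/-- The Artin–Schreier map `℘ = s_p − id` on differential forms. -/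
def asMap {p : ℕ} {F : Type*} [Field F] (S : DiffStr p F) : DF F →+ DF F :=
  S.sp - AddMonoidHom.id (DF F)

/-- The subgroup `℘Ω_F^n + dΩ_F^{n-1}` of `Ω_F^n`; the group `H_p^{n+1}(F)` is the quotient
of `Ω_F^n` by this subgroup. -/
def hRel {p : ℕ} {F : Type*} [Field F] (S : DiffStr p F) (n : ℕ) : AddSubgroup (DF F) :=
  ((omegaPow F n).toAddSubgroup.map (asMap S)) ⊔ ((omegaPred F n).toAddSubgroup.map S.d)

/-- The `t`-th iterate `v ↦ v^{[p^t]}` of the map `s_p`. -/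
def spIter {p : ℕ} {F : Type*} [Field F] (S : DiffStr p F) (t : ℕ) : DF F → DF F :=
  (fun x => S.sp x)^[t]

/-- `ν_n(F) = ker(℘ : Ω_F^n → Ω_F^n/dΩ_F^{n-1})`. -/
def nuSet {p : ℕ} {F : Type*} [Field F] (S : DiffStr p F) (n : ℕ) : Set (DF F) :=
  { η | η ∈ omegaPow F n ∧ ∃ z ∈ omegaPred F n, S.sp η - η = S.d z }

/-- Restriction of differential forms along a field extension `E/F`. -/
structure DiffRes (p : ℕ) (F E : Type*) [Field F] [Field E] [Algebra F E]
    (SF : DiffStr p F) (SE : DiffStr p E) where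
  res : DF F →+ DF E
  res_one : res 1 = 1
  res_mul : ∀ x y : DF F, res (x * y) = res x * res y
  res_smul : ∀ (a : F) (ω : DF F), res (a • ω) = algebraMap F E a • res ω
  res_dForm : ∀ a : F, res (dForm F a) = dForm E (algebraMap F E a)
  res_grade : ∀ n : ℕ, ∀ ω ∈ omegaPow F n, res ω ∈ omegaPow E n
  res_d : ∀ ω : DF F, res (SF.d ω) = SE.d (res ω)

namespace KM

open Finset

section ringlemmas

lemma choose_pred_cast {B : Type*} [Ring B] {p : ℕ} (hp : p.Prime) (h0 : (p : B) = 0) (m : ℕ)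
    (hm : m < p) : ((p - 1).choose m : B) = (-1) ^ m := by
  induction m with
  | zero => simp
  | succ m ih =>
    have h1 := Nat.choose_succ_succ (p - 1) m
    have h2 : p - 1 + 1 = p := Nat.sub_add_cancel hp.one_lt.le
    rw [Nat.succ_eq_add_one, h2] at h1
    have h3 : ((p.choose (m + 1) : ℕ) : B) = 0 := by
      obtain ⟨c, hc⟩ := hp.dvd_choose_self (Nat.succ_ne_zero m) hm
      rw [show m + 1 = m.succ from rfl, hc]; simp [h0]
    rw [h1] at h3
    push_cast at h3
    rw [ih (by omega)] at h3
    rw [pow_succ]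
    have := eq_neg_of_add_eq_zero_right h3
    simpa using this

lemma sub_pow_comm {B : Type*} [Ring B] {p : ℕ} (hp : p.Prime) (h0 : (p : B) = 0) {x y : B}
    (h : Commute x y) : (x - y) ^ p = x ^ p - y ^ p := by
  have h1 : Commute (x - y) y := h.sub_left (Commute.refl y)
  obtain ⟨r, hr⟩ := h1.exists_add_pow_prime_eq hp
  rw [h0] at hr
  simp at hr
  rw [hr]; simp

lemma sub_pow_pred {B : Type*} [Ring B] {p : ℕ} (hp : p.Prime) (h0 : (p : B) = 0) {x y : B}
    (h : Commute x y) : (x - y) ^ (p - 1) = ∑ i ∈ range p, x ^ i * y ^ (p - 1 - i) := by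
  have h2 : p - 1 + 1 = p := Nat.sub_add_cancel hp.one_lt.le
  rw [sub_eq_add_neg, (h.neg_right).add_pow, h2]
  refine Finset.sum_congr rfl fun i hi => ?_
  have hi' := Finset.mem_range.1 hi
  rw [← Nat.choose_symm (by omega), choose_pred_cast hp h0 _ (by omega), neg_pow y, mul_assoc]
  rw [mul_assoc]
  congr 1
  have : Commute (y ^ (p - 1 - i)) ((-1 : B) ^ (p - 1 - i)) := (Commute.neg_one_right _).pow_right _
  rw [this.eq, ← mul_assoc, ← pow_add, ← two_mul, pow_mul]
  simp

end ringlemmas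

section ad
variable {A : Type*} [Ring A]

/-- commutator with `a` -/
def adEnd (a : A) : Module.End ℤ A := LinearMap.mulLeft ℤ a - LinearMap.mulRight ℤ a

lemma adEnd_apply (a x : A) : adEnd a x = a * x - x * a := rfl

lemma mulL_comm (a b : A) : Commute (LinearMap.mulLeft ℤ a) (LinearMap.mulRight ℤ b) :=
  LinearMap.ext fun x => by simp [mul_assoc]

lemma end_cast_zero {M : Type*} [Ring M] {p : ℕ} (h0 : (p : M) = 0) :
    (p : Module.End ℤ M) = 0 := by
  ext x
  simp [Module.End.natCast_apply, h0]

lemma adEnd_pow_p {p : ℕ} (hp : p.Prime) (h0 : (p : A) = 0) (a x : A) :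
    (adEnd a ^ p) x = a ^ p * x - x * a ^ p := by
  unfold adEnd
  rw [sub_pow_comm hp (end_cast_zero h0) (mulL_comm a a)]
  simp [LinearMap.pow_mulLeft, LinearMap.pow_mulRight]

lemma adEnd_pow_pred {p : ℕ} (hp : p.Prime) (h0 : (p : A) = 0) (a x : A) :
    (adEnd a ^ (p - 1)) x = ∑ i ∈ range p, a ^ i * x * a ^ (p - 1 - i) := by
  unfold adEnd
  rw [sub_pow_pred hp (end_cast_zero h0) (mulL_comm a a)]
  simp [LinearMap.pow_mulLeft, LinearMap.pow_mulRight, mul_assoc]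

open Polynomial in
lemma derivative_pow_nc (u : A[X]) (n : ℕ) :
    derivative (u ^ n) = ∑ i ∈ range n, u ^ i * derivative u * u ^ (n - 1 - i) := by
  induction n with
  | zero => simp
  | succ n ih =>
    rw [pow_succ, derivative_mul, ih, Finset.sum_range_succ, Finset.sum_mul]
    simp only [Nat.add_sub_cancel, Nat.sub_self, pow_zero, mul_one]
    congr 1
    refine Finset.sum_congr rfl fun i hi => ?_
    have hi' := Finset.mem_range.1 hi
    rw [mul_assoc, ← pow_succ]
    congr 2; omega

open Polynomial in
/-- Jacobson's formula, in the case where all the iterated commutators commute with `f`. -/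
lemma jacobson {p : ℕ} (hp : p.Prime) (h0 : ∀ n : ℕ, ∀ x : A, (n : A) * x = 0 → (p ∣ n) ∨ x = 0)
    (h1 : (p : A) = 0) (a f : A)
    (hc : ∀ n, Commute f ((adEnd a ^ n) f)) :
    (a + f) ^ p = a ^ p + f ^ p + (adEnd a ^ (p - 1)) f := by
  have h1' : (p : A[X]) = 0 := by
    rw [← Polynomial.C_eq_natCast]; simp [h1]
  let u : A[X] := C a + C f * X
  have hu : derivative u = C f := by simp [u]
  have hXc : ∀ q : A[X], X * q = q * X := fun q => (Polynomial.X_mul (p := q))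
  have had : ∀ n, (adEnd u ^ n) (C f) = C ((adEnd a ^ n) f) := by
    intro n
    induction n with
    | zero => simp
    | succ n ih =>
      rw [pow_succ', Module.End.mul_apply, ih, pow_succ', Module.End.mul_apply, adEnd_apply,
        adEnd_apply]
      simp only [u, add_mul, mul_add, C_sub, C_mul]
      have e1 : C f * X * C ((adEnd a ^ n) f) = C ((adEnd a ^ n) f) * (C f * X) := by
        rw [mul_assoc, hXc, ← mul_assoc, ← mul_assoc, ← C_mul, ← C_mul, (hc n).eq]
      rw [e1]; abel
  have hd : derivative (u ^ p) = C ((adEnd a ^ (p - 1)) f) := by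
    rw [derivative_pow_nc, hu, ← adEnd_pow_pred hp h1', had]
  -- coefficients
  have hdeg : (u ^ p).natDegree ≤ p := by
    have : u.natDegree ≤ 1 := by
      simp only [u]
      compute_degree
    calc (u ^ p).natDegree ≤ p * u.natDegree := natDegree_pow_le
      _ ≤ p * 1 := by gcongr
      _ = p := mul_one p
  have hcoef : ∀ m, (u ^ p).coeff (m + 1) * ((m : A) + 1) = if m = 0 then (adEnd a ^ (p - 1)) f else 0 := by
    intro m
    have := congrArg (fun q => q.coeff m) hd
    simp only [coeff_derivative, coeff_C] at this
    exact this
  have hmid : ∀ m, 1 ≤ m → m + 1 < p → (u ^ p).coeff (m + 1) = 0 := by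
    intro m hm hmp
    have h := hcoef m
    rw [if_neg (by omega)] at h
    have h' : ((m + 1 : ℕ) : A) * (u ^ p).coeff (m + 1) = 0 := by
      rw [(Nat.cast_commute _ _).eq]; push_cast; exact h
    rcases h0 _ _ h' with h | h
    · exact absurd (Nat.le_of_dvd (by omega) h) (by omega)
    · exact h
  have hc1 : (u ^ p).coeff 1 = (adEnd a ^ (p - 1)) f := by simpa using hcoef 0
  have hc0 : (u ^ p).coeff 0 = a ^ p := by
    have : ∀ n, (u ^ n).coeff 0 = a ^ n := by
      intro n
      induction n with
      | zero => simp
      | succ n ih => rw [pow_succ, mul_coeff_zero, ih, pow_succ]; simp [u]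
    exact this p
  have hcp : (u ^ p).coeff p = f ^ p := by
    have : ∀ n, (u ^ n).natDegree ≤ n ∧ (u ^ n).coeff n = f ^ n := by
      intro n
      induction n with
      | zero => simp
      | succ n ih =>
        have hu1 : u.natDegree ≤ 1 := by simp only [u]; compute_degree
        refine ⟨?_, ?_⟩
        · rw [pow_succ]; exact natDegree_mul_le.trans (by omega)
        · rw [pow_succ, coeff_mul_add_eq_of_natDegree_le ih.1 hu1, ih.2, pow_succ]
          simp [u]
    exact (this p).2
  have heval : (u ^ p).eval 1 = (a + f) ^ p := by
    have : ∀ n, (u ^ n).eval 1 = (a + f) ^ n := by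
      intro n
      induction n with
      | zero => simp
      | succ n ih =>
        have hh : (u ^ n * u).eval 1 = (u ^ n).eval 1 * u.eval 1 :=
          eval₂_mul_noncomm (RingHom.id A) 1 fun k => Commute.one_right _
        rw [pow_succ, hh, ih, pow_succ]
        simp [u]
    exact this p
  rw [← heval, eval_eq_sum_range' (Nat.lt_succ_of_le hdeg)]
  simp only [one_pow, mul_one]
  rw [Finset.sum_range_succ, hcp]
  have h2 : p - 1 + 1 = p := Nat.sub_add_cancel hp.one_lt.le
  rw [← h2, Finset.sum_range_succ', h2, hc0]
  have h3 : p - 2 + 1 = p - 1 := by have := hp.two_le; omega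
  rw [← h3, Finset.sum_range_succ', h3, hc1, Finset.sum_eq_zero]
  · abel
  · intro m hm
    have := Finset.mem_range.1 hm
    exact hmid _ (by omega) (by omega)

end ad
end KM

namespace KM

open Finset

section der
variable {k : Type*} [Field k] {p : ℕ} [CharP k p]

/-- multiplication operator -/
abbrev mu (x : k) : Module.End ℤ k := LinearMap.mulLeft ℤ x

/-- derivation as an endomorphism -/
abbrev dE (D : Derivation ℤ k k) : Module.End ℤ k := (D : k →ₗ[ℤ] k)

lemma dE_apply (D : Derivation ℤ k k) (x : k) : dE D x = D x := rfl

lemma ad_mu (D : Derivation ℤ k k) (x : k) : adEnd (dE D) (mu x) = mu (D x) := by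
  ext y
  rw [adEnd_apply]
  simp [mul_comm]

lemma ad_mu_pow (D : Derivation ℤ k k) (x : k) (n : ℕ) :
    (adEnd (dE D) ^ n) (mu x) = mu ((dE D ^ n) x) := by
  induction n with
  | zero => simp
  | succ n ih =>
    rw [pow_succ', Module.End.mul_apply, ih, ad_mu, pow_succ', Module.End.mul_apply, dE_apply]

lemma dE_pow_p_mul (hp : p.Prime) (D : Derivation ℤ k k) (x y : k) :
    (dE D ^ p) (x * y) = x * (dE D ^ p) y + y * (dE D ^ p) x := by
  have h := adEnd_pow_p (A := Module.End ℤ k) hp (end_cast_zero (CharP.cast_eq_zero k p))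
    (dE D) (mu x)
  rw [ad_mu_pow] at h
  have h2 := congrArg (fun f => f y) h
  simp at h2
  rw [← sub_eq_iff_eq_add', ← h2, mul_comm]

/-- the `p`-th power of a derivation -/
def derP (hp : p.Prime) (D : Derivation ℤ k k) : Derivation ℤ k k :=
  Derivation.mk' (dE D ^ p) fun x y => by
    simpa using dE_pow_p_mul hp D x y

lemma derP_apply (hp : p.Prime) (D : Derivation ℤ k k) (x : k) :
    derP hp D x = (dE D ^ p) x := rfl

lemma der_const_mul (D : Derivation ℤ k k) {c : k} (hc : D c = 0) (x : k) :
    D (c * x) = c * D x := by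
  simp [hc]

lemma der_const_mul_pow (D : Derivation ℤ k k) {c : k} (hc : D c = 0) (n : ℕ) (x : k) :
    (dE D ^ n) (c * x) = c * (dE D ^ n) x := by
  induction n with
  | zero => simp
  | succ n ih =>
    rw [pow_succ', Module.End.mul_apply, ih, Module.End.mul_apply, dE_apply, dE_apply,
      der_const_mul D hc]

lemma der_pow_p (D : Derivation ℤ k k) (x : k) : D (x ^ p) = 0 := by
  rw [Derivation.leibniz_pow]
  simp

lemma jac_deriv (hp : p.Prime) (D : Derivation ℤ k k) (f : k) :
    (dE D + mu f) ^ p = dE D ^ p + mu (f ^ p + (dE D ^ (p - 1)) f) := by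
  rw [jacobson hp ?_ (end_cast_zero (CharP.cast_eq_zero k p)), ad_mu_pow]
  · rw [LinearMap.pow_mulLeft, add_assoc]
    congr 1
    ext y
    simp [add_mul]
  · intro n
    rw [ad_mu_pow]
    ext y
    simp only [Module.End.mul_apply, LinearMap.mulLeft_apply]
    ring
  · intro n x h
    by_cases hn : p ∣ n
    · exact Or.inl hn
    · right
      have hn' : (n : k) ≠ 0 := fun h => hn ((CharP.cast_eq_zero_iff k p n).1 h)
      ext y
      have := congrArg (fun f => f y) h
      simp only [Module.End.mul_apply, Module.End.natCast_apply, LinearMap.zero_apply,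
        nsmul_eq_mul, mul_eq_zero] at this
      simpa using this.resolve_left hn'

/-- `π_D = 1 - D^{p-1}` -/
def pr (p : ℕ) (D : Derivation ℤ k k) : Module.End ℤ k := 1 - dE D ^ (p - 1)

lemma pr_apply (D : Derivation ℤ k k) (x : k) : pr p D x = x - (dE D ^ (p - 1)) x := rfl

lemma pr_of_const (hp : p.Prime) (D : Derivation ℤ k k) {x : k} (hx : D x = 0) :
    pr p D x = x := by
  have h2 : p - 1 = (p - 2) + 1 := by have := hp.two_le; omega
  rw [pr_apply, h2, pow_succ, Module.End.mul_apply, dE_apply, hx]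
  simp

lemma pr_const_mul (D : Derivation ℤ k k) {c : k} (hc : D c = 0) (x : k) :
    pr p D (c * x) = c * pr p D x := by
  rw [pr_apply, pr_apply, der_const_mul_pow D hc, mul_sub]

lemma der_pr (hp : p.Prime) (D : Derivation ℤ k k) (hD : ∀ x, (dE D ^ p) x = D x) (x : k) :
    D (pr p D x) = 0 := by
  have h2 : p = p - 1 + 1 := (Nat.sub_add_cancel hp.one_lt.le).symm
  have h3 : (dE D ^ p) x = D ((dE D ^ (p - 1)) x) := by
    conv_lhs => rw [h2, pow_succ', Module.End.mul_apply, dE_apply]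
  rw [pr_apply, map_sub, ← h3, hD, sub_self]

lemma pr_der (hp : p.Prime) (D : Derivation ℤ k k) (hD : ∀ x, (dE D ^ p) x = D x) (x : k) :
    pr p D (D x) = 0 := by
  have h2 : p = p - 1 + 1 := (Nat.sub_add_cancel hp.one_lt.le).symm
  have h3 : (dE D ^ p) x = (dE D ^ (p - 1)) (D x) := by
    conv_lhs => rw [h2, pow_succ, Module.End.mul_apply, dE_apply]
  rw [pr_apply, ← h3, hD, sub_self]

lemma dlog_pr (hp : p.Prime) (D : Derivation ℤ k k) (hD : ∀ x, (dE D ^ p) x = D x) {e : k}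
    (he : e ≠ 0) : pr p D (D e / e) = (D e / e) ^ p := by
  have h := jac_deriv (p := p) hp D (D e / e)
  have hconj : dE D + mu (D e / e) = mu e⁻¹ * dE D * mu e := by
    ext y
    simp only [LinearMap.add_apply, dE_apply, LinearMap.mulLeft_apply, Module.End.mul_apply,
      Derivation.leibniz, smul_eq_mul]
    field_simp
  have hpow : ∀ n, (dE D + mu (D e / e)) ^ n = mu e⁻¹ * dE D ^ n * mu e := by
    intro n
    have hm : mu e * mu e⁻¹ = 1 := by
      ext y; simp [he]
    have hm' : mu e⁻¹ * mu e = 1 := by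
      ext y; simp [he]
    induction n with
    | zero => simp [hm']
    | succ n ih =>
      rw [pow_succ, ih, hconj, pow_succ]
      calc _ = mu e⁻¹ * dE D ^ n * (mu e * mu e⁻¹) * dE D * mu e := by simp only [mul_assoc]
        _ = _ := by rw [hm]; simp only [mul_assoc, mul_one]
  have hDp : dE D ^ p = dE D := LinearMap.ext hD
  rw [hpow, hDp, ← hconj] at h
  have h3 := congrArg (fun f => f 1) (add_left_cancel h)
  simp at h3
  rw [pr_apply, sub_eq_iff_eq_add]
  exact h3

end der
end KM

set_option linter.unusedSectionVars false
namespace KM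

open Finset

section eig

open Polynomial in
lemma exists_eig {M : Type*} [Field M] {p : ℕ} (hp : p.Prime) [CharP M p]
    (T : Module.End ℤ M) (hT : T ^ p = T) (K : AddSubgroup M) (hK : ∀ x ∈ K, T x ∈ K)
    (v : M) (hv : v ∈ K) (hv0 : v ≠ 0) :
    ∃ (c : ℕ) (e : M), e ∈ K ∧ e ≠ 0 ∧ T e = (c : M) * e := by
  classical
  have := Fact.mk hp
  have : CharP (Module.End ℤ M) p := by
    refine ⟨fun n => ?_⟩
    rw [← CharP.cast_eq_zero_iff M p]
    constructor
    · intro h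
      have := congrArg (fun f => f 1) h
      simpa [Module.End.natCast_apply] using this
    · intro h
      exact end_cast_zero h
  let : Algebra (ZMod p) (Module.End ℤ M) := ZMod.algebra _ p
  by_contra hcon
  push Not at hcon
  have halg : ∀ (c : ZMod p) (x : M), (algebraMap (ZMod p) (Module.End ℤ M) c) x = (c.val : M) * x := by
    intro c x
    conv_lhs => rw [← ZMod.natCast_zmod_val c, map_natCast]
    rw [Module.End.natCast_apply, nsmul_eq_mul]
  have key : ∀ s : Finset (ZMod p), (aeval T (∏ c ∈ s, (X - C c)) v) ∈ K ∧
      aeval T (∏ c ∈ s, (X - C c)) v ≠ 0 := by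
    intro s
    induction s using Finset.induction_on with
    | empty => simpa using ⟨hv, hv0⟩
    | insert a s ha ih =>
      rw [Finset.prod_insert ha, map_mul, Module.End.mul_apply]
      set y := aeval T (∏ c ∈ s, (X - C c)) v
      have : aeval T (X - C a) y = T y - (a.val : M) * y := by
        rw [map_sub, aeval_X, aeval_C, LinearMap.sub_apply, halg]
      rw [this]
      refine ⟨K.sub_mem (hK _ ih.1) ?_, ?_⟩
      · rw [← nsmul_eq_mul]; exact K.nsmul_mem ih.1 _
      · rw [sub_ne_zero]; exact hcon _ _ ih.1 ih.2
  have hprod : (∏ c : ZMod p, (X - C c)) = (X ^ p - X : (ZMod p)[X]) := by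
    have hr : roots (X ^ p - X : (ZMod p)[X]) = Finset.univ.val := by
      have := FiniteField.roots_X_pow_card_sub_X (ZMod p)
      rwa [ZMod.card] at this
    have hdeg := FiniteField.X_pow_card_sub_X_natDegree_eq (ZMod p) hp.one_lt
    have hmon : (X ^ p - X : (ZMod p)[X]).Monic :=
      monic_X_pow_sub (by rw [degree_X]; exact_mod_cast hp.one_lt)
    have := prod_multiset_X_sub_C_of_monic_of_roots_card_eq hmon (by
      rw [hr, hdeg]; simp [ZMod.card])
    rw [← this, hr]; rfl
  have h := (key Finset.univ).2
  rw [hprod] at h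
  simp [hT] at h

end eig

section ext

universe uk
variable {k : Type uk} [Field k] {p : ℕ} [CharP k p]

lemma exists_ext (hp : p.Prime) (h : k) (hh : h ≠ 0) :
    ∃ (M : Type uk) (_ : Field M) (_ : Algebra k M) (ρ : M), FiniteDimensional k M ∧
      Algebra.IsSeparable k M ∧ ρ ^ (p - 1) = algebraMap k M h⁻¹ ∧
      Algebra.adjoin k {ρ} = ⊤ ∧ (Module.finrank k M : k) ≠ 0 := by
  let Ω := AlgebraicClosure k
  have hp1 : 0 < p - 1 := Nat.sub_pos_of_lt hp.one_lt
  obtain ⟨ρ, hρ⟩ := IsAlgClosed.exists_pow_nat_eq (algebraMap k Ω h⁻¹) hp1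
  open Polynomial IntermediateField in
  have hIntegral : IsIntegral k ρ := (AlgebraicClosure.isAlgebraic k).isAlgebraic ρ |>.isIntegral
  have hsepX : (Polynomial.X ^ (p - 1) - Polynomial.C h⁻¹ : Polynomial k).Separable :=
    Polynomial.separable_X_pow_sub_C' p (p - 1) _
      (fun hd => absurd (Nat.le_of_dvd hp1 hd) (by omega)) (inv_ne_zero hh)
  have hdvd : minpoly k ρ ∣ (Polynomial.X ^ (p - 1) - Polynomial.C h⁻¹ : Polynomial k) :=
    minpoly.dvd _ _ (by simp [hρ])
  have hsep : IsSeparable k ρ := hsepX.of_dvd hdvd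
  let M := IntermediateField.adjoin k {ρ}
  have hfd : FiniteDimensional k M := IntermediateField.adjoin.finiteDimensional hIntegral
  refine ⟨M, inferInstance, inferInstance, IntermediateField.AdjoinSimple.gen k ρ, hfd,
    (IntermediateField.isSeparable_adjoin_simple_iff_isSeparable k _).2 hsep, ?_, ?_, ?_⟩
  · apply Subtype.ext
    exact hρ
  · have := (IntermediateField.adjoin.powerBasis hIntegral).adjoin_gen_eq_top
    rwa [IntermediateField.adjoin.powerBasis_gen hIntegral] at this
  · rw [IntermediateField.adjoin.finrank hIntegral]
    rw [Ne, CharP.cast_eq_zero_iff k p]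
    intro hd
    have h1 := Nat.le_of_dvd (minpoly.natDegree_pos hIntegral) hd
    have h2 := Polynomial.natDegree_le_of_dvd hdvd
      (Polynomial.X_pow_sub_C_ne_zero hp1 _)
    rw [Polynomial.natDegree_X_pow_sub_C] at h2
    omega

lemma trace_pow_p {M : Type*} [Field M] [Algebra k M] [FiniteDimensional k M]
    [Algebra.IsSeparable k M] (hp : p.Prime) (y : M) :
    Algebra.trace k M (y ^ p) = Algebra.trace k M y ^ p := by
  have := Fact.mk hp
  apply FaithfulSMul.algebraMap_injective k (AlgebraicClosure k)
  have : CharP (AlgebraicClosure k) p := charP_of_injective_algebraMap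
    (FaithfulSMul.algebraMap_injective k (AlgebraicClosure k)) p
  rw [trace_eq_sum_embeddings, map_pow, trace_eq_sum_embeddings, sum_pow_char]
  simp

lemma exists_der_ext {M : Type*} [Field M] [Algebra k M] [Algebra.IsSeparable k M]
    (D : Derivation ℤ k k) :
    ∃ D' : Derivation ℤ M M, ∀ a, D' (algebraMap k M a) = algebraMap k M (D a) := by
  have := Algebra.FormallyEtale.of_isSeparable k M
  let f : KaehlerDifferential ℤ k →ₗ[k] M :=
    (Algebra.linearMap k M) ∘ₗ D.liftKaehlerDifferential
  let g : TensorProduct k M (KaehlerDifferential ℤ k) →ₗ[M] M := LinearMap.liftBaseChange M f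
  let G : KaehlerDifferential ℤ M →ₗ[M] M := g ∘ₗ
    (KaehlerDifferential.tensorKaehlerEquivOfFormallyEtale ℤ k M).symm.toLinearMap
  refine ⟨G.compDer (KaehlerDifferential.D ℤ M), fun a => ?_⟩
  have := KaehlerDifferential.tensorKaehlerEquivOfFormallyEtale_symm_D_algebraMap ℤ k M a
  change g ((KaehlerDifferential.tensorKaehlerEquivOfFormallyEtale ℤ k M).symm
    (KaehlerDifferential.D ℤ M (algebraMap k M a))) = _
  rw [this]
  simp [g, f]

lemma span_pow_p {M : Type*} [Field M] [Algebra k M] (hp : p.Prime) {h : k} (hh : h ≠ 0) {ρ : M}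
    (hρ : ρ ^ (p - 1) = algebraMap k M h⁻¹) (hgen : Algebra.adjoin k {ρ} = ⊤)
    {P : M → Prop} (hadd : ∀ x y, P x → P y → P (x + y))
    (hP : ∀ (a : k) (y : M), P (algebraMap k M a * y ^ p)) (x : M) : P x := by
  have hx : x ∈ Subalgebra.toSubmodule (Algebra.adjoin k {ρ}) := by rw [hgen]; simp
  rw [Algebra.adjoin_eq_span] at hx
  have h2 : p - 1 + 1 = p := Nat.sub_add_cancel hp.one_lt.le
  have hρ1 : ρ = algebraMap k M h * ρ ^ p := by
    conv_rhs => rw [← h2, pow_succ, hρ, ← mul_assoc, ← map_mul, mul_inv_cancel₀ hh]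
    simp
  induction hx using Submodule.closure_induction with
  | zero => simpa [hp.ne_zero] using hP 0 0
  | add x y _ _ hx hy => exact hadd x y hx hy
  | smul_mem a y hy =>
    obtain ⟨n, rfl⟩ := Submonoid.mem_closure_singleton.1 hy
    have : ρ ^ n = algebraMap k M (h ^ n) * (ρ ^ n) ^ p := by
      conv_lhs => rw [hρ1, mul_pow, ← pow_mul, mul_comm p n, pow_mul, ← map_pow]
    rw [this, Algebra.smul_def, ← mul_assoc, ← map_mul]
    exact hP _ _

end ext
end KM

set_option linter.unusedSectionVars false
namespace KM

open Finset

section oneform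
universe uk
variable {k : Type uk} [Field k] {p : ℕ} [CharP k p]

lemma der_comm_pow {D D' : Derivation ℤ k k} (hc : ∀ x, D (D' x) = D' (D x)) (n : ℕ) (x : k) :
    D ((dE D' ^ n) x) = (dE D' ^ n) (D x) := by
  induction n with
  | zero => simp
  | succ n ih => rw [pow_succ', Module.End.mul_apply, Module.End.mul_apply, dE_apply, dE_apply, hc, ih]

lemma der_comm_pr {D D' : Derivation ℤ k k} (hc : ∀ x, D (D' x) = D' (D x)) (x : k) :
    D (pr p D' x) = pr p D' (D x) := by
  rw [pr_apply, pr_apply, map_sub, der_comm_pow hc]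

lemma poincare1 (hp : p.Prime) {ι : Type*} (D : ι → Derivation ℤ k k)
    (hcomm : ∀ i j x, D i (D j x) = D j (D i x)) (hDp : ∀ i x, (dE (D i) ^ p) x = D i x)
    (r : ι → k) (hr : ∀ i j, D i (r j) = D j (r i)) (hpr : ∀ i, pr p (D i) (r i) = 0)
    (S : Finset ι) : ∃ s, ∀ l ∈ S, D l s = r l := by
  classical
  induction S using Finset.induction_on with
  | empty => exact ⟨0, by simp⟩
  | insert a S ha ih =>
    obtain ⟨s, hs⟩ := ih
    have h2 : p - 2 + 1 = p - 1 := by have := hp.two_le; omega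
    set y := r a - D a s with hy
    have hpy : pr p (D a) y = 0 := by
      rw [hy, map_sub, hpr, pr_der hp _ (hDp a), sub_zero]
    refine ⟨s + (dE (D a) ^ (p - 2)) y, fun l hl => ?_⟩
    rcases Finset.mem_insert.1 hl with rfl | hl
    · rw [map_add]
      have h3 : D l ((dE (D l) ^ (p - 2)) y) = (dE (D l) ^ (p - 1)) y := by
        rw [← h2, pow_succ', Module.End.mul_apply, dE_apply]
      rw [h3]
      rw [pr_apply, sub_eq_zero] at hpy
      rw [← hpy, hy]; ring
    · rw [map_add, hs l hl, der_comm_pow (hcomm l a), hy, map_sub, hr l a, hcomm l a, hs l hl]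
      simp

lemma oneForm (hp : p.Prime) {ι : Type*} [Fintype ι] [LinearOrder ι] (D : ι → Derivation ℤ k k)
    (hcomm : ∀ i j x, D i (D j x) = D j (D i x)) (hDp : ∀ i x, (dE (D i) ^ p) x = D i x)
    (m : ι) (h : k) (hm : pr p (D m) h = 1) (hj : ∀ j, m < j → D j h = 0) :
    ∃ (θ : ι → k) (s : k), θ m = 1 ∧ (∀ j, m < j → θ j = 0) ∧
      ∀ l, h * θ l - θ l ^ p = D l s := by
  classical
  have := Fact.mk hp
  have hh : h ≠ 0 := by
    rintro rfl
    simp at hm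
  suffices H : ∃ f : ι → k, (∀ i j, D i (f j) = D j (f i)) ∧
      (∀ l, pr p (D l) (f l) = (h⁻¹) ^ p * f l ^ p) ∧ f m = h ∧ ∀ j, m < j → f j = 0 by
    obtain ⟨f, hf1, hf2, hf3, hf4⟩ := H
    have hr : ∀ l, D l ((h⁻¹ * f l) ^ p) = 0 := fun l => der_pow_p _ _
    obtain ⟨s, hs⟩ := poincare1 (p := p) hp D hcomm hDp (fun l => f l - (h⁻¹ * f l) ^ p)
      (fun i j => by rw [map_sub, map_sub, der_pow_p, der_pow_p, hf1])
      (fun i => by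
        rw [map_sub, pr_of_const hp _ (hr i), hf2, mul_pow, sub_self]) Finset.univ
    refine ⟨fun l => h⁻¹ * f l, s, ?_, ?_, ?_⟩
    · simp [hf3, hh]
    · intro j hj; simp [hf4 j hj]
    · intro l
      rw [hs l (Finset.mem_univ l), mul_inv_cancel_left₀ hh]
  obtain ⟨M, _, _, ρ, hfd, hsep, hρ, hgen, hN⟩ := exists_ext (p := p) hp h hh
  have : CharP M p := charP_of_injective_algebraMap (FaithfulSMul.algebraMap_injective k M) p
  have hinj := FaithfulSMul.algebraMap_injective k M
  choose D' hD' using fun i => exists_der_ext (M := M) (D i)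
  set a := algebraMap k M with ha
  have hD'm : ∀ i x (y : M), D' i (a x * y ^ p) = a (D i x) * y ^ p := by
    intro i x y
    rw [Derivation.leibniz, der_pow_p, hD']
    simp [mul_comm]
  have hD'c : ∀ i j x, D' i (D' j x) = D' j (D' i x) := by
    intro i j x
    induction x using span_pow_p hp hh hρ hgen with
    | hadd x y hx hy => simp only [map_add, hx, hy]
    | hP b y => simp only [← ha]; rw [hD'm, hD'm, hD'm, hD'm, hcomm]
  have hD'n : ∀ i n x (y : M), (dE (D' i) ^ n) (a x * y ^ p) = a ((dE (D i) ^ n) x) * y ^ p := by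
    intro i n x y
    induction n with
    | zero => simp
    | succ n ih =>
      rw [pow_succ', Module.End.mul_apply, ih, dE_apply, hD'm, pow_succ', Module.End.mul_apply,
        dE_apply]
  have hD'p : ∀ i x, (dE (D' i) ^ p) x = D' i x := by
    intro i x
    induction x using span_pow_p hp hh hρ hgen with
    | hadd x y hx hy => simp only [map_add, hx, hy]
    | hP b y => simp only [← ha]; rw [hD'n, hD'm, hDp]
  have hTr : ∀ i x, Algebra.trace k M (D' i x) = D i (Algebra.trace k M x) := by
    intro i x
    induction x using span_pow_p hp hh hρ hgen with
    | hadd x y hx hy => simp only [map_add, hx, hy]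
    | hP b y =>
      simp only [← ha]
      rw [hD'm, ha, ← Algebra.smul_def, ← Algebra.smul_def, map_smul, map_smul, trace_pow_p hp]
      simp [der_pow_p, mul_comm]
  set τ := ρ ^ p with hτ
  have hτc : ∀ i, D' i τ = 0 := fun i => der_pow_p _ _
  have hρ0 : ρ ≠ 0 := by
    rintro rfl
    rw [zero_pow (Nat.sub_pos_of_lt hp.one_lt).ne'] at hρ
    exact inv_ne_zero hh (hinj (by rw [← hρ, map_zero]))
  have hτ0 : τ ≠ 0 := pow_ne_zero _ hρ0
  have hτp : τ ^ (p - 1) = a (h⁻¹ ^ p) := by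
    rw [hτ, ← pow_mul, mul_comm, pow_mul, hρ, map_pow]
  have h21 : p - 1 + 1 = p := Nat.sub_add_cancel hp.one_lt.le
  have hτh : (τ * a h) ^ p = τ := by
    rw [mul_pow, ← map_pow]
    conv_lhs => rw [← h21, pow_succ, hτp, h21]
    rw [mul_right_comm, ← map_mul, ← mul_pow, inv_mul_cancel₀ hh]
    simp
  -- the operator nabla
  set T : Module.End ℤ M := dE (D' m) + mu (-(τ * a h)) with hT
  have hTp : T ^ p = T := by
    rw [hT, jac_deriv hp]
    have e1 : dE (D' m) ^ p = dE (D' m) := LinearMap.ext (hD'p m)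
    rw [e1]
    congr 2
    have e2 : (dE (D m) ^ (p - 1)) h = h - 1 := by
      rw [pr_apply] at hm
      rw [← hm]; ring
    have e3 : (dE (D' m) ^ (p - 1)) (τ * a h) = τ * a (h - 1) := by
      rw [mul_comm, hτ, hD'n, e2, mul_comm]
    rw [map_neg, e3, neg_pow, hτh, neg_one_pow_char, map_sub, map_one]
    ring
  let K : AddSubgroup M := ⨅ (j : ι) (_ : m < j), (dE (D' j)).toAddMonoidHom.ker
  have hK : ∀ x, x ∈ K ↔ ∀ j, m < j → D' j x = 0 := by
    intro x
    simp only [K, AddSubgroup.mem_iInf, AddMonoidHom.mem_ker]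
    rfl
  obtain ⟨c, e, heK, he0, he⟩ := exists_eig hp T hTp K (by
    intro x hx
    rw [hK] at hx ⊢
    intro j hmj
    simp only [hT, LinearMap.add_apply, dE_apply, LinearMap.mulLeft_apply, map_add]
    rw [hD'c, hx j hmj, Derivation.leibniz, hx j hmj, map_neg, Derivation.leibniz, hτc, hD', hj j hmj]
    simp) 1 (by rw [hK]; intro j _; simp) one_ne_zero
  rw [hK] at heK
  let c' : ι → M := fun l => if l = m then (c : M) else 0
  have hc'D : ∀ i l, D' i (c' l) = 0 := by
    intro i l; simp only [c']; split_ifs <;> simp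
  have hc'p : ∀ l, c' l ^ p = c' l := by
    intro l; simp only [c']; split_ifs
    · rw [← frobenius_def, map_natCast]
    · exact zero_pow hp.ne_zero
  let G : ι → M := fun l => D' l e / e - c' l
  have hG1 : ∀ i j, D' i (G j) = D' j (G i) := by
    intro i j
    simp only [G, map_sub, hc'D, Derivation.leibniz_div, hD'c i j]
    simp only [smul_eq_mul, sub_zero]
    ring
  have hG2 : ∀ l, pr p (D' l) (G l) = G l ^ p := by
    intro l
    simp only [G]
    rw [map_sub, dlog_pr hp _ (hD'p l) he0, pr_of_const hp _ (hc'D l l), sub_pow_char, hc'p]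
  have hG3 : G m = τ * a h := by
    simp only [hT, LinearMap.add_apply, dE_apply, LinearMap.mulLeft_apply] at he
    simp only [G, c', if_pos]
    field_simp
    linear_combination he
  have hG4 : ∀ j, m < j → G j = 0 := by
    intro j hmj
    simp [G, c', heK j hmj, hmj.ne']
  -- the trace
  let N : k := Module.finrank k M
  let φ : M → k := fun x => N⁻¹ * Algebra.trace k M (τ⁻¹ * x)
  have hND : ∀ i, D i N⁻¹ = 0 := by
    intro i; rw [Derivation.leibniz_inv]; simp [N]
  have hφD : ∀ i x, D i (φ x) = φ (D' i x) := by
    intro i x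
    simp only [φ]
    rw [der_const_mul _ (hND i), ← hTr, der_const_mul]
    rw [Derivation.leibniz_inv, hτc, smul_zero]
  have hφs : ∀ x y, φ (x - y) = φ x - φ y := by
    intro x y; simp only [φ, mul_sub, map_sub]
  have hφDn : ∀ i n x, (dE (D i) ^ n) (φ x) = φ ((dE (D' i) ^ n) x) := by
    intro i n x
    induction n with
    | zero => simp
    | succ n ih => rw [pow_succ', Module.End.mul_apply, ih, dE_apply, hφD, pow_succ', Module.End.mul_apply, dE_apply]
  refine ⟨fun l => φ (G l), fun i j => ?_, fun l => ?_, ?_, fun j hmj => ?_⟩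
  · simp only [hφD]; rw [hG1]
  · simp only
    rw [pr_apply, hφDn, ← hφs, ← pr_apply, hG2]
    simp only [φ]
    have hNp : (N⁻¹) ^ p = N⁻¹ := by
      rw [inv_pow]; simp only [N]; rw [← frobenius_def, map_natCast]
    rw [mul_pow N⁻¹, hNp, ← trace_pow_p hp, mul_pow, mul_left_comm, ← smul_eq_mul (h⁻¹ ^ p),
      ← map_smul, Algebra.smul_def, ← ha, ← hτp]
    congr 2
    rw [← mul_assoc]
    congr 1
    rw [← h21, Nat.add_sub_cancel, pow_succ, ← mul_assoc, ← mul_pow, mul_inv_cancel₀ hτ0]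
    simp
  · simp only [hG3, φ]
    rw [inv_mul_cancel_left₀ hτ0, ha, Algebra.trace_algebraMap]
    simp only [nsmul_eq_mul]
    rw [← mul_assoc, inv_mul_cancel₀ hN, one_mul]
  · simp [hG4 j hmj, φ]

end oneform
end KM

set_option linter.unusedSectionVars false
namespace KM

open Finset

section sign
variable {ι : Type*} [LinearOrder ι]

/-- the sign of inserting `l` in `σ` -/
def sg (l : ι) (σ : Finset ι) : ℤ := (-1) ^ (σ.filter (· < l)).card

lemma sg_mul_self (l : ι) (σ : Finset ι) : sg l σ * sg l σ = 1 := by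
  unfold sg
  rw [← pow_add, ← two_mul, pow_mul]; simp

lemma sg_erase_of_lt {l j : ι} {σ : Finset ι} (hl : l ∈ σ) (h : l < j) :
    sg j (σ.erase l) = - sg j σ := by
  unfold sg
  have h1 : (σ.erase l).filter (· < j) = (σ.filter (· < j)).erase l := by
    ext x; simp; tauto
  have h2 : l ∈ σ.filter (· < j) := by simp [hl, h]
  rw [h1]
  conv_rhs => rw [← Finset.card_erase_add_one h2, pow_succ]
  ring

lemma sg_erase_of_gt {l j : ι} {σ : Finset ι} (h : j ≤ l) :
    sg j (σ.erase l) = sg j σ := by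
  unfold sg
  congr 2
  ext x; simp
  intro hx _ e
  subst e
  exact absurd (lt_of_lt_of_le hx h) (lt_irrefl _)

lemma alt_sum {A : Type*} [AddCommGroup A] (σ : Finset ι) (G : ι → ι → A) :
    ∑ l ∈ σ, ∑ j ∈ σ.erase l, sg l σ • sg j (σ.erase l) • (G l j + G j l) = 0 := by
  have hanti : ∀ l ∈ σ, ∀ j ∈ σ, l ≠ j → sg l σ * sg j (σ.erase l) = - (sg j σ * sg l (σ.erase j)) := by
    intro l hl j hj hne
    rcases lt_or_gt_of_ne hne with h | h
    · rw [sg_erase_of_lt hl h, sg_erase_of_gt h.le]; ring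
    · rw [sg_erase_of_lt hj h, sg_erase_of_gt h.le]; ring
  have : ∑ l ∈ σ, ∑ j ∈ σ.erase l, sg l σ • sg j (σ.erase l) • (G l j + G j l)
      = ∑ x ∈ σ.offDiag, (sg x.1 σ * sg x.2 (σ.erase x.1)) • (G x.1 x.2 + G x.2 x.1) := by
    rw [Finset.sum_sigma']
    refine Finset.sum_bij' (fun x _ => (x.1, x.2)) (fun x _ => ⟨x.1, x.2⟩) ?_ ?_ ?_ ?_ ?_
    · rintro ⟨a, b⟩ h; simp at h ⊢; tauto
    · rintro ⟨a, b⟩ h; simp at h ⊢; tauto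
    · rintro ⟨a, b⟩ h; rfl
    · rintro ⟨a, b⟩ h; rfl
    · rintro ⟨a, b⟩ h; simp [mul_smul]
  rw [this]
  refine Finset.sum_involution (fun x _ => (x.2, x.1)) ?_ ?_ ?_ ?_
  · rintro ⟨a, b⟩ h
    simp at h
    simp only
    rw [hanti a h.1 b h.2.1 h.2.2, add_comm (G b a), ← add_smul]; simp
  · rintro ⟨a, b⟩ h _ e
    simp at h e
    exact h.2.2 e.1.symm
  · rintro ⟨a, b⟩ h
    simp at h ⊢; tauto
  · rintro ⟨a, b⟩ h; rfl

end sign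

/-- a commuting system of derivations with `D^p = D` -/
structure DSys (p : ℕ) (k : Type*) [Field k] (ι : Type*) where
  D : ι → Derivation ℤ k k
  comm : ∀ i j x, D i (D j x) = D j (D i x)
  pow : ∀ i x, (dE (D i) ^ p) x = D i x

namespace DSys
universe uk
variable {k : Type uk} [Field k] {p : ℕ} [CharP k p] {ι : Type*} [LinearOrder ι]
  (X : DSys p k ι)

lemma commE (i j : ι) : Commute (pr p (X.D i)) (pr p (X.D j)) := by
  have h : Commute (dE (X.D i)) (dE (X.D j)) := LinearMap.ext fun x => X.comm i j x
  have h2 : Commute (dE (X.D i) ^ (p - 1)) (dE (X.D j) ^ (p - 1)) := h.pow_pow _ _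
  unfold pr
  exact ((Commute.one_left _).sub_left ((Commute.one_right _).sub_right h2))

lemma commP (S : Finset ι) :
    (S : Set ι).Pairwise (Function.onFun Commute fun l => pr p (X.D l)) :=
  fun i _ j _ _ => X.commE i j

/-- product of projections -/
def P (S : Finset ι) : Module.End ℤ k :=
  S.noncommProd (fun l => pr p (X.D l)) (X.commP S)

lemma P_empty : X.P ∅ = 1 := Finset.noncommProd_empty _ _

lemma P_insert {a : ι} {S : Finset ι} (h : a ∉ S) (x : k) :
    X.P (insert a S) x = pr p (X.D a) (X.P S x) := by
  unfold P
  rw [Finset.noncommProd_insert_of_notMem _ _ _ _ h]; rfl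

lemma D_P (j : ι) (S : Finset ι) (x : k) : X.D j (X.P S x) = X.P S (X.D j x) := by
  induction S using Finset.induction_on with
  | empty => rw [P_empty]; rfl
  | insert a S ha ih =>
    rw [P_insert _ ha, P_insert _ ha, der_comm_pr (X.comm j a), ih]

lemma pr_P (j : ι) (S : Finset ι) (x : k) :
    pr p (X.D j) (X.P S x) = X.P S (pr p (X.D j) x) := by
  induction S using Finset.induction_on with
  | empty => rw [P_empty]; rfl
  | insert a S ha ih =>
    rw [P_insert _ ha, P_insert _ ha, ← ih]
    have := congrArg (fun f => f (X.P S x)) (X.commE j a).eq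
    exact this

lemma P_insert' {a : ι} {S : Finset ι} (h : a ∉ S) (x : k) :
    X.P (insert a S) x = X.P S (pr p (X.D a) x) := by
  rw [P_insert _ h, pr_P]

lemma D_P_mem (hp : p.Prime) {j : ι} {S : Finset ι} (hj : j ∈ S) (x : k) :
    X.D j (X.P S x) = 0 := by
  rw [← Finset.insert_erase hj, P_insert _ (Finset.notMem_erase _ _), der_pr hp _ (X.pow j)]

lemma P_D_mem (hp : p.Prime) {j : ι} {S : Finset ι} (hj : j ∈ S) (x : k) :
    X.P S (X.D j x) = 0 := by
  rw [← D_P, D_P_mem X hp hj]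

lemma P_const (hp : p.Prime) {S : Finset ι} {x : k} (h : ∀ j ∈ S, X.D j x = 0) :
    X.P S x = x := by
  induction S using Finset.induction_on with
  | empty => rw [P_empty]; rfl
  | insert a S ha ih =>
    rw [P_insert _ ha, ih fun j hj => h j (Finset.mem_insert_of_mem hj),
      pr_of_const hp _ (h a (Finset.mem_insert_self _ _))]

/-- wedge with a one form -/
def act (θ : ι → k) (f : Finset ι → k) : Finset ι → k :=
  fun σ => ∑ l ∈ σ, sg l σ • (θ l * f (σ.erase l))

/-- differential -/
def dd (f : Finset ι → k) : Finset ι → k :=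
  fun σ => ∑ l ∈ σ, sg l σ • X.D l (f (σ.erase l))

lemma dd_add (f g : Finset ι → k) : X.dd (fun σ => f σ + g σ) = fun σ => X.dd f σ + X.dd g σ := by
  ext σ; simp only [dd, map_add, smul_add, Finset.sum_add_distrib]

lemma dd_sub (f g : Finset ι → k) : X.dd (fun σ => f σ - g σ) = fun σ => X.dd f σ - X.dd g σ := by
  ext σ; simp only [dd, map_sub, smul_sub, Finset.sum_sub_distrib]

lemma dd_neg (f : Finset ι → k) : X.dd (fun σ => - f σ) = fun σ => - X.dd f σ := by
  ext σ; simp only [dd, map_neg, smul_neg, Finset.sum_neg_distrib]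

lemma dd_zsmul (c : ℤ) (f : Finset ι → k) : X.dd (fun σ => c • f σ) = fun σ => c • X.dd f σ := by
  ext σ; simp only [dd, Finset.smul_sum]
  refine Finset.sum_congr rfl fun l _ => ?_
  rw [map_zsmul, smul_comm]

lemma dd_const (c : k) (hc : ∀ j, X.D j c = 0) (f : Finset ι → k) :
    X.dd (fun σ => c * f σ) = fun σ => c * X.dd f σ := by
  ext σ; simp only [dd, Finset.mul_sum]
  refine Finset.sum_congr rfl fun l _ => ?_
  rw [der_const_mul _ (hc l), mul_smul_comm]

lemma dd_dd (f : Finset ι → k) (σ : Finset ι) : X.dd (X.dd f) σ = 0 := by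
  classical
  simp only [dd, map_sum, Finset.smul_sum, map_zsmul]
  rw [← alt_sum σ (fun l j => if l < j then X.D l (X.D j (f ((σ.erase l).erase j))) else 0)]
  refine Finset.sum_congr rfl fun l _ => Finset.sum_congr rfl fun j hj => ?_
  have hne : j ≠ l := (Finset.mem_erase.1 hj).1
  congr 2
  rcases lt_or_gt_of_ne hne with h | h
  · rw [if_neg h.asymm, if_pos h, zero_add, X.comm, Finset.erase_right_comm]
  · rw [if_pos h, if_neg h.asymm, add_zero]

lemma dd_pow (f : Finset ι → k) (σ : Finset ι) : X.dd (fun σ => f σ ^ p) σ = 0 := by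
  simp only [dd]
  exact Finset.sum_eq_zero fun l _ => by rw [der_pow_p, smul_zero]

lemma act_pow (hp : p.Prime) (θ : ι → k) (f : Finset ι → k) (σ : Finset ι) :
    act (fun l => θ l ^ p) (fun σ => f σ ^ p) σ = (act θ f σ) ^ p := by
  have := Fact.mk hp
  simp only [act]
  rw [sum_pow_char]
  refine Finset.sum_congr rfl fun l _ => ?_
  rw [zsmul_eq_mul, zsmul_eq_mul, mul_pow, mul_pow, ← frobenius_def p ((sg l σ : ℤ) : k), map_intCast]

lemma act_const_dd (θ : ι → k) (hθ : ∀ i l, X.D i (θ l) = 0) (f : Finset ι → k) (σ : Finset ι) :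
    act θ (X.dd f) σ = - X.dd (act θ f) σ := by
  classical
  rw [← add_eq_zero_iff_eq_neg]
  simp only [dd, act, map_sum, Finset.smul_sum, map_zsmul, Finset.mul_sum]
  rw [← Finset.sum_add_distrib]
  simp only [← Finset.sum_add_distrib]
  rw [← alt_sum σ (fun l j => θ l * X.D j (f ((σ.erase l).erase j)))]
  refine Finset.sum_congr rfl fun l _ => Finset.sum_congr rfl fun j hj => ?_
  rw [der_const_mul _ (hθ l j), mul_smul_comm, ← smul_add, ← smul_add, Finset.erase_right_comm (a := j)]

lemma act_exact (s : k) (g : Finset ι → k) (hg : ∀ σ, X.dd g σ = 0) (σ : Finset ι) :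
    act (fun l => X.D l s) g σ = X.dd (fun σ => s * g σ) σ := by
  have : X.dd (fun σ => s * g σ) σ = act (fun l => X.D l s) g σ + s * X.dd g σ := by
    simp only [dd, act, Finset.mul_sum]
    rw [← Finset.sum_add_distrib]
    refine Finset.sum_congr rfl fun l _ => ?_
    rw [Derivation.leibniz, mul_smul_comm, ← smul_add, add_comm, smul_eq_mul, smul_eq_mul, mul_comm (g _)]
  rw [this, hg, mul_zero, add_zero]

end DSys
end KM

set_option linter.unusedSectionVars false
namespace KM

open Finset

namespace DSys
universe uk
variable {k : Type uk} [Field k] {p : ℕ} [CharP k p] {ι : Type*} [LinearOrder ι] [Fintype ι]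
  (X : DSys p k ι)

lemma colex_aux {α' σ : Finset ι} {m l : ι} (hα : ∀ x ∈ α', x < m) (hlm : l ≤ m)
    (h : toColex (σ.erase l) ≤ toColex α') : toColex σ ≤ toColex (insert m α') := by
  have hlt : ∀ x ∈ σ.erase l, x < m := Finset.Colex.forall_lt_mono h hα
  rw [Finset.Colex.toColex_le_toColex] at h ⊢
  intro a ha haα
  have ham : a ≠ m := fun e => haα (by simp [e])
  have haα' : a ∉ α' := fun e => haα (by simp [e])
  rcases hlm.eq_or_lt with rfl | hlm
  · obtain ⟨b, hb, hb1, hb2⟩ := h (Finset.mem_erase.2 ⟨ham, ha⟩) haα'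
    refine ⟨b, Finset.mem_insert_of_mem hb, fun hbσ => hb1 ?_, hb2⟩
    exact Finset.mem_erase.2 ⟨(hα b hb).ne, hbσ⟩
  · refine ⟨m, Finset.mem_insert_self _ _, fun hm => ?_, ?_⟩
    · exact absurd (hlt m (Finset.mem_erase.2 ⟨hlm.ne', hm⟩)) (lt_irrefl _)
    · by_cases hal : a = l
      · rw [hal]; exact hlm.le
      · exact (hlt a (Finset.mem_erase.2 ⟨hal, ha⟩)).le

lemma lemW (hp : p.Prime) (α : Finset ι) : ∀ g : k,
    (∀ j, j ∉ α → X.D j (X.P (α.filter (j < ·)) g) = 0) → X.P α g ≠ 0 →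
    ∃ (f s : Finset ι → k), (∀ σ, (g / X.P α g) * f σ - f σ ^ p = X.dd s σ) ∧ f α = 1 ∧
      ∀ σ, toColex α < toColex σ → f σ = 0 := by
  have := Fact.mk hp
  induction α using Finset.induction_on_max with
  | empty =>
    intro g hg hg0
    rw [P_empty] at hg0 ⊢
    have hg0' : g ≠ 0 := hg0
    refine ⟨fun σ => if σ = ∅ then 1 else 0, fun _ => 0, fun σ => ?_, by simp, fun σ hσ => ?_⟩
    · have h1 : g / (1 : Module.End ℤ k) g = 1 := div_self hg0'
      rw [h1]
      simp only [dd, map_zero, smul_zero, Finset.sum_const_zero]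
      split_ifs <;> simp [hp.ne_zero]
    · change (if σ = ∅ then (1:k) else 0) = 0
      rw [if_neg]
      rintro rfl
      exact lt_irrefl _ hσ
  | insert m α' hα ih =>
    intro g hg hg0
    have hm : m ∉ α' := fun h => lt_irrefl _ (hα m h)
    have hgt : ∀ j, m < j → X.D j g = 0 := by
      intro j hj
      have h1 : j ∉ insert m α' := by
        intro h
        rcases Finset.mem_insert.1 h with rfl | h
        · exact lt_irrefl _ hj
        · exact lt_asymm hj (hα _ h)
      have h2 : (insert m α').filter (j < ·) = ∅ := by
        ext x; simp only [Finset.mem_filter, Finset.mem_insert, Finset.notMem_empty, iff_false]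
        rintro ⟨rfl | h, h'⟩
        · exact lt_asymm hj h'
        · exact lt_asymm (hj.trans h') (hα _ h)
      have := hg j h1
      rwa [h2, P_empty] at this
    set g' := pr p (X.D m) g with hg'
    have hPg' : X.P α' g' = X.P (insert m α') g := by rw [P_insert' _ hm]
    have hDg' : ∀ j, m ≤ j → X.D j g' = 0 := by
      intro j hj
      rcases hj.eq_or_lt with rfl | hj
      · exact der_pr hp _ (X.pow m) _
      · rw [hg', der_comm_pr (X.comm j m), hgt j hj, map_zero]
    obtain ⟨f', s', hfs₂, hf'1, hf'0⟩ := ih g' (by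
      intro j hj
      rcases lt_or_ge j m with hjm | hjm
      · have h1 : j ∉ insert m α' := by simp [hj, hjm.ne]
        have h2 : (insert m α').filter (j < ·) = insert m (α'.filter (j < ·)) := by
          rw [Finset.filter_insert, if_pos hjm]
        have h3 := hg j h1
        rwa [h2, P_insert' _ (by simp [hm])] at h3
      · have h2 : α'.filter (j < ·) = ∅ := by
          ext x; simp only [Finset.mem_filter, Finset.notMem_empty, iff_false]
          rintro ⟨h, h'⟩
          exact lt_asymm (lt_of_le_of_lt hjm h') (hα _ h)
        rw [h2, P_empty]
        exact hDg' j hjm) (by rwa [hPg'])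
    have hg'0 : g' ≠ 0 := by
      intro h; rw [h, map_zero] at hPg'; exact hg0 hPg'.symm
    have hinv : ∀ j, m ≤ j → X.D j g'⁻¹ = 0 := by
      intro j hj; rw [Derivation.leibniz_inv, hDg' j hj, smul_zero]
    obtain ⟨θ, s, hθ1, hθ0, hθs⟩ := oneForm hp X.D X.comm X.pow m (g'⁻¹ * g)
      (by rw [pr_const_mul _ (hinv m le_rfl), ← hg', inv_mul_cancel₀ hg'0])
      (by intro j hj; rw [der_const_mul _ (hinv j hj.le), hgt j hj, mul_zero])
    -- the closed form
    set h' := g' / X.P α' g' with hh'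
    have hcl : ∀ σ, X.dd (fun σ => h' * f' σ) σ = 0 := by
      intro σ
      have e : (fun σ => h' * f' σ) = fun σ => f' σ ^ p + X.dd s' σ := by
        ext σ; rw [← hfs₂ σ]; ring
      rw [e, dd_add]
      simp only
      rw [dd_pow, dd_dd, add_zero]
    have hprod : ∀ σ, (g / X.P (insert m α') g) * act θ f' σ - act θ f' σ ^ p
        = X.dd (fun σ => - act (fun l => θ l ^ p) s' σ + s * (h' * f' σ)) σ := by
      intro σ
      rw [dd_add, dd_neg]
      simp only
      rw [← act_exact X s _ hcl,
        ← act_const_dd X (fun l => θ l ^ p) (fun i l => der_pow_p _ _), ← act_pow hp]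
      have e2 : (g / X.P (insert m α') g) = (g'⁻¹ * g) * h' := by
        rw [hh', hPg']; field_simp
      rw [e2]
      simp only [act, Finset.mul_sum]
      rw [sub_eq_iff_eq_add, ← Finset.sum_add_distrib, ← Finset.sum_add_distrib]
      refine Finset.sum_congr rfl fun l _ => ?_
      rw [mul_smul_comm, ← smul_add, ← smul_add]
      congr 1
      rw [← hθs, ← hfs₂ (σ.erase l)]
      ring
    have hf1 : act θ f' (insert m α') = sg m (insert m α') := by
      simp only [act]
      rw [Finset.sum_eq_single m]
      · rw [Finset.erase_insert hm, hθ1, hf'1]; simp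
      · intro l hl hlm
        have hl' : l ∈ α' := (Finset.mem_insert.1 hl).resolve_left hlm
        rw [hf'0 _, mul_zero, smul_zero]
        refine lt_of_not_ge fun hle => ?_
        have := Finset.Colex.forall_lt_mono hle hα m (by simp [Ne.symm hlm])
        exact lt_irrefl _ this
      · intro h; exact absurd (Finset.mem_insert_self _ _) h
    have hf0 : ∀ σ, toColex (insert m α') < toColex σ → act θ f' σ = 0 := by
      intro σ hσ
      simp only [act]
      refine Finset.sum_eq_zero fun l hl => ?_
      rcases lt_or_ge m l with hml | hml
      · rw [hθ0 l hml]; simp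
      · rw [hf'0 _, mul_zero, smul_zero]
        refine lt_of_not_ge fun hle => ?_
        exact absurd (colex_aux hα hml hle) (not_le_of_gt hσ)
    set ε := sg m (insert m α') with hε
    refine ⟨fun σ => ε • act θ f' σ,
      fun σ => ε • (- act (fun l => θ l ^ p) s' σ + s * (h' * f' σ)), fun σ => ?_, ?_, ?_⟩
    · rw [dd_zsmul]
      simp only
      rw [← hprod, zsmul_eq_mul, zsmul_eq_mul, mul_pow, ← frobenius_def p ((ε : ℤ) : k),
        map_intCast]
      ring
    · simp only
      rw [hf1, zsmul_eq_mul]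
      exact_mod_cast congrArg (Int.cast : ℤ → k) (sg_mul_self m (insert m α'))
    · intro σ hσ
      simp only [hf0 σ hσ, smul_zero]

/-- The model theorem. -/
theorem model (hp : p.Prime) (T : Finset ι) (hT : ∀ t ∈ T, ∀ j, t < j → j ∈ T)
    (ω u v : Finset ι → k) (heq : ∀ σ, ω σ = u σ ^ p - u σ + X.dd v σ)
    (h1 : ∀ σ, ¬ Disjoint σ T → ω σ = 0) (h2 : ∀ σ, ∀ t ∈ T, X.D t (ω σ) = 0) :
    ∃ u' v' : Finset ι → k, (∀ σ, ω σ = u' σ ^ p - u' σ + X.dd v' σ) ∧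
      (∀ σ, ¬ Disjoint σ T → u' σ = 0) ∧ (∀ σ, ¬ Disjoint σ T → v' σ = 0) ∧
      (∀ σ, ∀ t ∈ T, X.D t (u' σ) = 0) ∧ (∀ σ, ∀ t ∈ T, X.D t (v' σ) = 0) := by
  classical
  have := Fact.mk hp
  -- `d u` vanishes on sets meeting `T`
  have hdu : ∀ u v : Finset ι → k, (∀ σ, ω σ = u σ ^ p - u σ + X.dd v σ) →
      ∀ σ, ¬ Disjoint σ T → X.dd u σ = 0 := by
    intro u v heq σ hσ
    have e : u = fun σ => (u σ ^ p + X.dd v σ) - ω σ := by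
      ext σ; rw [heq]; ring
    rw [e, dd_sub, dd_add]
    simp only
    rw [dd_pow, dd_dd, add_zero, zero_sub, neg_eq_zero]
    refine Finset.sum_eq_zero fun l hl => ?_
    by_cases hd : Disjoint (σ.erase l) T
    · have hlT : l ∈ T := by
        by_contra hlT
        apply hσ
        rw [← Finset.insert_erase hl, Finset.disjoint_insert_left]
        exact ⟨hlT, hd⟩
      rw [h2 _ l hlT, smul_zero]
    · rw [h1 _ hd, map_zero, smul_zero]
  suffices H : ∃ u v : Finset ι → k, (∀ σ, ω σ = u σ ^ p - u σ + X.dd v σ) ∧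
      ∀ σ, ¬ Disjoint σ T → u σ = 0 by
    obtain ⟨u, v, heq, hu⟩ := H
    have hDu : ∀ σ, ∀ t ∈ T, X.D t (u σ) = 0 := by
      intro σ t ht
      by_cases hd : Disjoint σ T
      · have htσ : t ∉ σ := fun h => Finset.disjoint_left.1 hd h ht
        have h3 := hdu u v heq (insert t σ) (by
          rw [Finset.disjoint_insert_left]; tauto)
        simp only [dd] at h3
        rw [Finset.sum_eq_single t] at h3
        · rw [Finset.erase_insert htσ] at h3
          have h4 := congrArg (fun x => sg t (insert t σ) • x) h3
          simp only [smul_zero] at h4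
          rwa [smul_smul, sg_mul_self, one_smul] at h4
        · intro l hl hlt
          rw [hu, map_zero, smul_zero]
          rw [Finset.not_disjoint_iff]
          exact ⟨t, by simp [Ne.symm hlt], ht⟩
        · intro h; exact absurd (Finset.mem_insert_self _ _) h
      · rw [hu σ hd, map_zero]
    refine ⟨u, fun σ => if Disjoint σ T then X.P T (v σ) else 0, fun σ => ?_, hu, ?_, hDu, ?_⟩
    · by_cases hd : Disjoint σ T
      · have e1 : X.dd (fun σ => if Disjoint σ T then X.P T (v σ) else 0) σ = X.P T (X.dd v σ) := by
          simp only [dd, map_sum, map_zsmul]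
          refine Finset.sum_congr rfl fun l _ => ?_
          rw [if_pos (Finset.disjoint_of_subset_left (Finset.erase_subset _ _) hd), D_P]
        rw [e1]
        have e2 : X.P T (ω σ) = ω σ := P_const X hp (h2 σ)
        have e3 : X.P T (u σ) = u σ := P_const X hp (hDu σ)
        have e4 : X.P T (u σ ^ p) = u σ ^ p := P_const X hp fun j _ => der_pow_p _ _
        have h5 := congrArg (fun x => X.P T x) (heq σ)
        simp only [map_add, map_sub] at h5
        rw [e2, e3, e4] at h5
        exact h5
      · rw [h1 σ hd, hu σ hd, zero_pow hp.ne_zero, sub_zero, zero_add]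
        symm
        refine Finset.sum_eq_zero fun l hl => ?_
        by_cases hd' : Disjoint (σ.erase l) T
        · have hlT : l ∈ T := by
            by_contra hlT
            apply hd
            rw [← Finset.insert_erase hl, Finset.disjoint_insert_left]
            exact ⟨hlT, hd'⟩
          simp only
          rw [if_pos hd', D_P_mem X hp hlT, smul_zero]
        · simp only
          rw [if_neg hd', map_zero, smul_zero]
    · intro σ hd; exact if_neg hd
    · intro σ t ht
      simp only
      split_ifs
      · exact D_P_mem X hp ht _
      · exact map_zero _
  -- induction
  suffices H : ∀ A : WithTop (Colex (Finset ι)), ∀ u v : Finset ι → k,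
      (∀ σ, ω σ = u σ ^ p - u σ + X.dd v σ) →
      (∀ σ, ¬ Disjoint σ T → u σ ≠ 0 → ((toColex σ : Colex (Finset ι)) : WithTop _) < A) →
      ∃ u v : Finset ι → k, (∀ σ, ω σ = u σ ^ p - u σ + X.dd v σ) ∧
      ∀ σ, ¬ Disjoint σ T → u σ = 0 from
    H ⊤ u v heq fun σ _ _ => WithTop.coe_lt_top _
  intro A
  have : Finite (Colex (Finset ι)) := Finite.of_equiv (Finset ι) toColex
  have : WellFoundedLT (Colex (Finset ι)) := Finite.to_wellFoundedLT
  induction A using WellFoundedLT.induction with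
  | ind A ih =>
  intro u v heq hA
  by_cases hbad : ∀ σ, ¬ Disjoint σ T → u σ = 0
  · exact ⟨u, v, heq, hbad⟩
  push Not at hbad
  obtain ⟨σ₀, hσ₀⟩ := hbad
  obtain ⟨α, hα, hmax⟩ := Finset.exists_max_image
    (Finset.univ.filter fun σ => ¬ Disjoint σ T ∧ u σ ≠ 0) (fun σ => toColex σ) ⟨σ₀, by simpa using hσ₀⟩
  simp only [Finset.mem_filter, Finset.mem_univ, true_and] at hα hmax
  obtain ⟨hαT, hy⟩ := hα
  have hlead : ∀ σ, ¬ Disjoint σ T → toColex α < toColex σ → u σ = 0 := by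
    intro σ hσ hlt
    by_contra h
    exact absurd (hmax σ ⟨hσ, h⟩) (not_le_of_gt hlt)
  have hc1 : X.P α (u α) = u α ^ p := by
    have h3 := congrArg (fun x => X.P α x) (heq α)
    simp only [map_add, map_sub, h1 α hαT, map_zero] at h3
    have e4 : X.P α (u α ^ p) = u α ^ p := P_const X hp fun j _ => der_pow_p _ _
    have e5 : X.P α (X.dd v α) = 0 := by
      simp only [dd, map_sum, map_zsmul]
      exact Finset.sum_eq_zero fun l hl => by rw [P_D_mem X hp hl, smul_zero]
    rw [e4, e5, add_zero] at h3
    exact (sub_eq_zero.1 h3.symm).symm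
  have hc2 : ∀ j, j ∉ α → X.D j (X.P (α.filter (j < ·)) (u α)) = 0 := by
    intro j hj
    have hm : ¬ Disjoint (insert j α) T := by
      rw [Finset.disjoint_insert_left]; tauto
    have h3 := congrArg (fun x => X.P (α.filter (j < ·)) x) (hdu u v heq _ hm)
    simp only [dd, map_sum, map_zsmul, map_zero] at h3
    rw [Finset.sum_eq_single j] at h3
    · rw [Finset.erase_insert hj, ← D_P] at h3
      have h4 := congrArg (fun x => sg j (insert j α) • x) h3
      simp only [smul_zero] at h4
      rwa [smul_smul, sg_mul_self, one_smul] at h4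
    · intro l hl hlj
      have hlα : l ∈ α := (Finset.mem_insert.1 hl).resolve_left hlj
      rcases lt_or_gt_of_ne hlj with h | h
      · rw [hlead, map_zero, map_zero, smul_zero]
        · obtain ⟨t, htα, htT⟩ := Finset.not_disjoint_iff.1 hαT
          by_cases htl : t = l
          · subst htl
            exact Finset.not_disjoint_iff.2 ⟨j, by simp [Ne.symm hlj], hT _ htT j h⟩
          · exact Finset.not_disjoint_iff.2 ⟨t, by simp [htl, htα], htT⟩
        · have := (Finset.Colex.erase_lt_erase (Finset.mem_insert_self j α) hl).2 h
          rwa [Finset.erase_insert hj] at this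
      · rw [P_D_mem X hp (by simp [hlα, h]), smul_zero]
    · intro h; exact absurd (Finset.mem_insert_self _ _) h
  obtain ⟨f, s, hfs, hf1, hf0⟩ := X.lemW hp α (u α) hc2 (by rw [hc1]; exact pow_ne_zero _ hy)
  rw [hc1] at hfs
  refine ih (toColex α : Colex (Finset ι)) (hA α hαT hy) (fun σ => u σ - u α * f σ)
    (fun σ => v σ - u α ^ p * s σ) (fun σ => ?_) (fun σ hσ hne => ?_)
  · rw [dd_sub, dd_const X _ (fun j => der_pow_p _ _)]
    simp only
    rw [← hfs, heq, sub_pow_char, mul_pow]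
    have hyp : u α ^ p ≠ 0 := pow_ne_zero _ hy
    field_simp
    ring
  · rw [WithTop.coe_lt_coe]
    by_contra hle
    apply hne
    rcases (not_lt.1 hle).eq_or_lt with h | h
    · have : α = σ := toColex_inj.1 h
      subst this
      simp only [hf1, mul_one, sub_self]
    · simp only [hlead σ hσ h, hf0 σ h, mul_zero, sub_zero]

end DSys
end KM

set_option linter.unusedSectionVars false
namespace KM

open Finset Polynomial

section step
variable {F E : Type*} [Field F] [Field E] [Algebra F E]

/-- `D` behaves like a derivation on the intermediate field `L`. -/
structure IsDerOn (L : IntermediateField F E) (D : E → E) : Prop where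
  add : ∀ x ∈ L, ∀ y ∈ L, D (x + y) = D x + D y
  mul : ∀ x ∈ L, ∀ y ∈ L, D (x * y) = x * D y + y * D x

open DualNumber in
/-- The ring homomorphism to dual numbers attached to a partial derivation. -/
noncomputable def IsDerOn.hom {L : IntermediateField F E} {D : E → E} (h : IsDerOn L D) :
    L →+* DualNumber E where
  toFun x := (TrivSqZeroExt.inl (x : E) : DualNumber E) + TrivSqZeroExt.inr (D x)
  map_one' := by
    have h1 := h.mul 1 L.one_mem 1 L.one_mem
    simp only [mul_one, one_mul, left_eq_add] at h1
    ext <;> simp [h1]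
  map_mul' x y := by
    ext
    · simp
    · simp [h.mul x x.2 y y.2]; ring
  map_zero' := by
    have h1 := h.add 0 L.zero_mem 0 L.zero_mem
    simp only [add_zero, left_eq_add] at h1
    ext <;> simp [h1]
  map_add' x y := by
    ext
    · simp
    · simp [h.add x x.2 y y.2]

lemma IsDerOn.hom_fst {L : IntermediateField F E} {D : E → E} (h : IsDerOn L D) (x : L) :
    (h.hom x).fst = x := by simp [IsDerOn.hom]

lemma IsDerOn.hom_snd {L : IntermediateField F E} {D : E → E} (h : IsDerOn L D) (x : L) :
    (h.hom x).snd = D x := by simp [IsDerOn.hom]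

lemma step {p : ℕ} (hp : p.Prime) [CharP E p] (L : IntermediateField F E) (D : E → E)
    (h : IsDerOn L D) (β : E) (hβ : β ∉ L) (hb : β ^ p ∈ L) (hDb : D (β ^ p) = 0) (v : E) :
    ∃ D' : E → E, IsDerOn (L ⊔ IntermediateField.adjoin F {β}) D' ∧ D' β = v ∧
      ∀ x ∈ L, D' x = D x := by
  classical
  have := Fact.mk hp
  let b : L := ⟨β ^ p, hb⟩
  have hirr : Irreducible (X ^ p - C b : L[X]) := by
    refine X_pow_sub_C_irreducible_of_prime hp fun y hy => hβ ?_
    have h1 : (y : E) ^ p = β ^ p := congrArg Subtype.val hy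
    have h2 : (y : E) = β := frobenius_inj E p h1
    rw [← h2]; exact y.2
  have hmon : (X ^ p - C b : L[X]).Monic := monic_X_pow_sub_C _ hp.ne_zero
  have hroot : aeval β (X ^ p - C b : L[X]) = 0 := by
    simp [b]
  have hmin := minpoly.eq_of_irreducible_of_monic hirr hroot hmon
  let w : DualNumber E := TrivSqZeroExt.inl β + TrivSqZeroExt.inr v
  have hw : w ^ p = h.hom b := by
    ext
    · rw [TrivSqZeroExt.fst_pow, IsDerOn.hom_fst]; simp [w, b]
    · rw [TrivSqZeroExt.snd_pow, IsDerOn.hom_snd]; simp [b, hDb]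
  let ev := eval₂RingHom h.hom w
  have hfst : ∀ f : L[X], (ev f).fst = aeval β f := by
    intro f
    induction f using Polynomial.induction_on' with
    | add f g hf hg => simp only [map_add, TrivSqZeroExt.fst_add, hf, hg]
    | monomial n a =>
      simp [ev, eval₂_monomial, IsDerOn.hom_fst, w, aeval_monomial]
  have hwd : ∀ f : L[X], aeval β f = 0 → ev f = 0 := by
    intro f hf
    have h1 := minpoly.dvd L β hf
    rw [← hmin] at h1
    obtain ⟨g, rfl⟩ := h1
    rw [map_mul]
    have : ev (X ^ p - C b) = 0 := by
      simp [ev, hw]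
    rw [this, zero_mul]
  have hwd' : ∀ f g : L[X], aeval β f = aeval β g → ev f = ev g := by
    intro f g hfg
    rw [← sub_eq_zero, ← map_sub]
    exact hwd _ (by rw [map_sub, hfg, sub_self])
  let D' : E → E := fun x => if hx : ∃ f : L[X], aeval β f = x then (ev hx.choose).snd else 0
  have hD' : ∀ f : L[X], D' (aeval β f) = (ev f).snd := by
    intro f
    have hx : ∃ g : L[X], aeval β g = aeval β f := ⟨f, rfl⟩
    simp only [D', dif_pos hx]
    rw [hwd' _ _ hx.choose_spec]
  have hmem : ∀ x ∈ L ⊔ IntermediateField.adjoin F {β}, ∃ f : L[X], aeval β f = x := by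
    intro x hx
    have hIntegral : IsIntegral L β := ⟨_, hmon, by simpa [aeval_def] using hroot⟩
    have h1 : x ∈ (IntermediateField.adjoin L {β}).restrictScalars F := by
      rw [IntermediateField.restrictScalars_adjoin_eq_sup]; exact hx
    rw [IntermediateField.mem_restrictScalars] at h1
    have h2 := (IntermediateField.adjoin_simple_toSubalgebra_of_isAlgebraic hIntegral.isAlgebraic).le h1
    rw [Algebra.adjoin_singleton_eq_range_aeval] at h2
    exact h2
  refine ⟨D', ⟨fun x hx y hy => ?_, fun x hx y hy => ?_⟩, ?_, fun x hx => ?_⟩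
  · obtain ⟨f, rfl⟩ := hmem x hx
    obtain ⟨g, rfl⟩ := hmem y hy
    rw [← map_add, hD', hD', hD', map_add, TrivSqZeroExt.snd_add]
  · obtain ⟨f, rfl⟩ := hmem x hx
    obtain ⟨g, rfl⟩ := hmem y hy
    rw [← map_mul, hD', hD', hD', map_mul, TrivSqZeroExt.snd_mul, hfst, hfst]
    simp; ring
  · have := hD' X
    rw [aeval_X] at this
    rw [this]; simp [ev, w]
  · have := hD' (C ⟨x, hx⟩)
    rw [aeval_C] at this
    change D' x = _ at this
    rw [this]; simp [ev, IsDerOn.hom_snd]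

lemma stepAll {p : ℕ} (hp : p.Prime) [CharP E p] {r : ℕ} (b : Fin r → F) (β : Fin r → E)
    (hβ : ∀ i, β i ^ p = algebraMap F E (b i)) (D : E → E) (h : IsDerOn (⊥ : IntermediateField F E) D)
    (hD : ∀ i, D (algebraMap F E (b i)) = 0) (s : Finset (Fin r)) :
    ∃ D' : E → E, IsDerOn (IntermediateField.adjoin F (β '' s)) D' ∧
      ∀ f : F, D' (algebraMap F E f) = D (algebraMap F E f) := by
  classical
  induction s using Finset.induction_on with
  | empty => exact ⟨D, by simpa using h, fun _ => rfl⟩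
  | insert i s hi ih =>
    obtain ⟨D', h', hD'⟩ := ih
    have e : IntermediateField.adjoin F (β '' (insert i s : Finset (Fin r))) =
        IntermediateField.adjoin F (β '' s) ⊔ IntermediateField.adjoin F {β i} := by
      rw [← IntermediateField.adjoin_union]
      congr 1
      rw [Finset.coe_insert, Set.image_insert_eq, Set.insert_eq, Set.union_comm]
    rw [e]
    by_cases hm : β i ∈ IntermediateField.adjoin F (β '' s)
    · refine ⟨D', ?_, hD'⟩
      rwa [sup_eq_left.2]
      simpa using hm
    · obtain ⟨D'', h'', -, h3⟩ := step hp _ D' h' (β i) hm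
        (by rw [hβ]; exact IntermediateField.algebraMap_mem _ _) (by rw [hβ, hD', hD]) 0
      exact ⟨D'', h'', fun f => by
        rw [h3 _ (IntermediateField.algebraMap_mem _ _), hD']⟩

/-- A globally defined partial derivation is a derivation. -/
noncomputable def IsDerOn.toDer {D : E → E} (h : IsDerOn (⊤ : IntermediateField F E) D) :
    Derivation ℤ E E :=
  Derivation.mk' (AddMonoidHom.mk' D (fun x y => h.add x trivial y trivial)).toIntLinearMap
    (fun x y => by simpa using h.mul x trivial y trivial)

lemma IsDerOn.toDer_apply {D : E → E} (h : IsDerOn (⊤ : IntermediateField F E) D) (x : E) :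
    h.toDer x = D x := rfl

lemma lemY {p : ℕ} (hp : p.Prime) [CharP E p] {r : ℕ} (b : Fin r → F) (β : Fin r → E)
    (hβ : ∀ i, β i ^ p = algebraMap F E (b i))
    (hgen : Algebra.adjoin F (Set.range β) = ⊤) (δ : Derivation ℤ F F) (hδ : ∀ i, δ (b i) = 0) :
    ∃ D : Derivation ℤ E E, ∀ f, D (algebraMap F E f) = algebraMap F E (δ f) := by
  classical
  let D0 : E → E := fun x => if hx : ∃ f : F, algebraMap F E f = x
    then algebraMap F E (δ hx.choose) else 0
  have hD0 : ∀ f, D0 (algebraMap F E f) = algebraMap F E (δ f) := by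
    intro f
    have hx : ∃ g : F, algebraMap F E g = algebraMap F E f := ⟨f, rfl⟩
    simp only [D0, dif_pos hx]
    rw [(algebraMap F E).injective hx.choose_spec]
  have h0 : IsDerOn (⊥ : IntermediateField F E) D0 := by
    constructor
    · intro x hx y hy
      obtain ⟨f, rfl⟩ := IntermediateField.mem_bot.1 hx
      obtain ⟨g, rfl⟩ := IntermediateField.mem_bot.1 hy
      rw [← map_add, hD0, hD0, hD0, map_add, map_add]
    · intro x hx y hy
      obtain ⟨f, rfl⟩ := IntermediateField.mem_bot.1 hx
      obtain ⟨g, rfl⟩ := IntermediateField.mem_bot.1 hy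
      rw [← map_mul, hD0, hD0, hD0, Derivation.leibniz, map_add]
      simp
  obtain ⟨D', h', hD'⟩ := stepAll hp b β hβ D0 h0 (fun i => by rw [hD0, hδ, map_zero]) Finset.univ
  have e : IntermediateField.adjoin F (β '' (Finset.univ : Finset (Fin r))) = ⊤ := by
    rw [Finset.coe_univ, Set.image_univ, eq_top_iff]
    intro x _
    have : x ∈ Algebra.adjoin F (Set.range β) := by rw [hgen]; trivial
    exact IntermediateField.algebra_adjoin_le_adjoin F _ this
  rw [e] at h'
  exact ⟨h'.toDer, fun f => by rw [IsDerOn.toDer_apply, hD', hD0]⟩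

/-- A minimal generating subset. -/
lemma exists_min {r : ℕ} (β : Fin r → E)
    (hgen : Algebra.adjoin F (Set.range β) = ⊤) :
    ∃ I : Finset (Fin r), IntermediateField.adjoin F (β '' I) = ⊤ ∧
      ∀ i ∈ I, β i ∉ IntermediateField.adjoin F (β '' (I.erase i : Finset (Fin r))) := by
  classical
  have e : IntermediateField.adjoin F (β '' (Finset.univ : Finset (Fin r))) = ⊤ := by
    rw [Finset.coe_univ, Set.image_univ, eq_top_iff]
    intro x _
    have : x ∈ Algebra.adjoin F (Set.range β) := by rw [hgen]; trivial
    exact IntermediateField.algebra_adjoin_le_adjoin F _ this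
  obtain ⟨I, hI, hmin⟩ := Finset.exists_min_image
    (Finset.univ.filter fun I : Finset (Fin r) => IntermediateField.adjoin F (β '' I) = ⊤)
    Finset.card ⟨Finset.univ, by simpa using e⟩
  simp only [Finset.mem_filter, Finset.mem_univ, true_and] at hI hmin
  refine ⟨I, hI, fun i hi hmem => ?_⟩
  have h1 : IntermediateField.adjoin F (β '' (I.erase i : Finset (Fin r))) = ⊤ := by
    rw [eq_top_iff, ← hI, IntermediateField.adjoin_le_iff]
    rintro _ ⟨j, hj, rfl⟩
    by_cases hji : j = i
    · rw [hji]; exact hmem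
    · exact IntermediateField.subset_adjoin _ _ ⟨j, by simpa [hji] using hj, rfl⟩
  have h2 := hmin _ h1
  have h3 := Finset.card_erase_lt_of_mem hi
  omega

lemma exists_dual {p : ℕ} (hp : p.Prime) [CharP E p] {r : ℕ} (b : Fin r → F) (β : Fin r → E)
    (hβ : ∀ i, β i ^ p = algebraMap F E (b i)) (I : Finset (Fin r))
    (hI : IntermediateField.adjoin F (β '' I) = ⊤) (i : Fin r)
    (hmin : β i ∉ IntermediateField.adjoin F (β '' (I.erase i : Finset (Fin r)))) :
    ∃ D : Derivation ℤ E E, (∀ f, D (algebraMap F E f) = 0) ∧ D (β i) = β i ∧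
      ∀ j ∈ I, j ≠ i → D (β j) = 0 := by
  classical
  have e : IntermediateField.adjoin F (β '' (I.erase i : Finset (Fin r))) ⊔
      IntermediateField.adjoin F {β i} = ⊤ := by
    rw [eq_top_iff, ← hI, IntermediateField.adjoin_le_iff]
    rintro _ ⟨j, hj, rfl⟩
    by_cases hji : j = i
    · rw [hji]
      exact (le_sup_right : _ ≤ IntermediateField.adjoin F (β '' (I.erase i : Finset (Fin r))) ⊔
        IntermediateField.adjoin F {β i}) (IntermediateField.mem_adjoin_simple_self _ _)
    · exact (le_sup_left : _ ≤ IntermediateField.adjoin F (β '' (I.erase i : Finset (Fin r))) ⊔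
        IntermediateField.adjoin F {β i})
        (IntermediateField.subset_adjoin _ _ ⟨j, by simpa [hji] using hj, rfl⟩)
  obtain ⟨D', h', h1, h2⟩ := step hp (IntermediateField.adjoin F (β '' (I.erase i : Finset (Fin r))))
    (fun _ => 0) ⟨by simp, by simp⟩ (β i) hmin
    (by rw [hβ]; exact IntermediateField.algebraMap_mem _ _) rfl (β i)
  rw [e] at h'
  refine ⟨h'.toDer, fun f => h2 _ (IntermediateField.algebraMap_mem _ _), h1, fun j hj hji => ?_⟩
  exact h2 _ (IntermediateField.subset_adjoin _ _ ⟨j, by simpa [hji] using hj, rfl⟩)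

end step
end KM

set_option linter.unusedSectionVars false
namespace KM

open Finset

/-- A `p`-basis of `E` adapted to the extension `E/F`. -/
structure Adapted (p : ℕ) (F E : Type*) [Field F] [Field E] [Algebra F E] {r : ℕ} (b : Fin r → F)
    (ι : Type*) [LinearOrder ι] where
  T : Finset ι
  upper : ∀ t ∈ T, ∀ j, t < j → j ∈ T
  x : ι → E
  c : ι → F
  D : ι → Derivation ℤ E E
  x_ne : ∀ i, x i ≠ 0
  D_self : ∀ i, D i (x i) = x i
  D_ne : ∀ i j, i ≠ j → D i (x j) = 0
  comm : ∀ i j a, D i (D j a) = D j (D i a)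
  pow : ∀ i a, (dE (D i) ^ p) a = D i a
  x_c : ∀ i, i ∉ T → x i = algebraMap F E (c i)
  fin : ∀ a, ∃ s : Finset ι, (∀ i, i ∉ s → D i a = 0) ∧
    KaehlerDifferential.D ℤ E a = ∑ i ∈ s, D i a • ((x i)⁻¹ • KaehlerDifferential.D ℤ E (x i))
  mem : ∀ a, (∀ t ∈ T, D t a = 0) ↔ a ∈ Set.range (algebraMap F E)
  spanF : ∀ z : KaehlerDifferential ℤ F, z ∈ Submodule.span F
    ((fun i => KaehlerDifferential.D ℤ F (c i)) '' {i | i ∉ T} ∪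
      Set.range fun i => KaehlerDifferential.D ℤ F (b i))

section
variable {E : Type*} [Field E]

lemma der_eq_of_span {ι : Type*} (x : ι → E)
    (hspan : ⊤ ≤ Submodule.span E (Set.range fun i => KaehlerDifferential.D ℤ E (x i)))
    (D D' : Derivation ℤ E E) (h : ∀ i, D (x i) = D' (x i)) (a : E) : D a = D' a := by
  have h1 : D.liftKaehlerDifferential = D'.liftKaehlerDifferential := by
    refine LinearMap.ext_on_range (top_le_iff.1 hspan) fun i => ?_
    simpa using h i
  have h2 := congrArg (fun f => f (KaehlerDifferential.D ℤ E a)) h1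
  simpa using h2
end

section
variable {F E : Type*} [Field F] [Field E] [Algebra F E]

lemma der_monom {p : ℕ} [CharP E p] (D : Derivation ℤ E E) (hF : ∀ f, D (algebraMap F E f) = 0)
    {κ : Type*} (s : Finset κ) (β : κ → E) (m : κ → ℕ) (i : κ) (hi : i ∈ s) (hDi : D (β i) = β i)
    (hD : ∀ j ∈ s, j ≠ i → D (β j) = 0) (f : F) :
    D (algebraMap F E f * ∏ j ∈ s, β j ^ m j) = m i * (algebraMap F E f * ∏ j ∈ s, β j ^ m j) := by
  classical
  rw [← Finset.mul_prod_erase _ _ hi]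
  have h1 : D (∏ j ∈ s.erase i, β j ^ m j) = 0 := by
    refine Finset.prod_induction _ (fun y => D y = 0) (fun a b ha hb => ?_) (by simp)
      fun j hj => ?_
    · rw [Derivation.leibniz, ha, hb]; simp
    · rw [Derivation.leibniz_pow, hD j (Finset.mem_of_mem_erase hj) (Finset.ne_of_mem_erase hj)]
      simp
  rw [Derivation.leibniz, hF, Derivation.leibniz, h1, Derivation.leibniz_pow, hDi]
  rcases Nat.eq_zero_or_pos (m i) with h0 | h0
  · simp [h0]
  · simp only [smul_eq_mul, nsmul_eq_mul, mul_zero, add_zero, zero_add]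
    rw [← Nat.sub_add_cancel h0, pow_succ]
    simp only [Nat.add_sub_cancel]
    ring

lemma K3 {p : ℕ} (hp : p.Prime) [CharP E p] {κ : Type*} [DecidableEq κ] (s : Finset κ) (b : κ → F)
    (β : κ → E) (hβ : ∀ i, β i ^ p = algebraMap F E (b i))
    (D : κ → Derivation ℤ E E) (hF : ∀ i, ∀ f, D i (algebraMap F E f) = 0)
    (hDi : ∀ i ∈ s, D i (β i) = β i) (hD : ∀ i ∈ s, ∀ j ∈ s, j ≠ i → D i (β j) = 0)
    (x : E) (hx : x ∈ Algebra.adjoin F (β '' s)) (hDx : ∀ i ∈ s, D i x = 0) :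
    x ∈ Set.range (algebraMap F E) := by
  have := Fact.mk hp
  let S : Finset κ → AddSubgroup E := fun t => AddSubgroup.closure
    {y | ∃ (f : F) (m : κ → ℕ), (∀ i ∈ t, p ∣ m i) ∧ y = algebraMap F E f * ∏ j ∈ s, β j ^ m j}
  have h0 : x ∈ S ∅ := by
    clear hDx
    induction hx using Algebra.adjoin_induction with
    | mem x hx => 
      obtain ⟨i, hi, rfl⟩ := hx
      refine AddSubgroup.subset_closure ⟨1, fun j => if j = i then 1 else 0, by simp, ?_⟩
      simp [pow_ite, Finset.prod_ite_eq', Finset.mem_coe.1 hi]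
    | algebraMap f =>
      exact AddSubgroup.subset_closure ⟨f, fun _ => 0, by simp, by simp⟩
    | add x y _ _ hx hy => exact add_mem hx hy
    | mul x y hx0 hy0 hx hy =>
      clear hx0 hy0
      induction hx using AddSubgroup.closure_induction with
      | zero => rw [zero_mul]; exact zero_mem _
      | add a b _ _ ha hb => rw [add_mul]; exact add_mem ha hb
      | neg a _ ha => rw [neg_mul]; exact neg_mem ha
      | mem x hx =>
        induction hy using AddSubgroup.closure_induction with
        | zero => rw [mul_zero]; exact zero_mem _
        | add a b _ _ ha hb => rw [mul_add]; exact add_mem ha hb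
        | neg a _ ha => rw [mul_neg]; exact neg_mem ha
        | mem y hy =>
          obtain ⟨f, m, -, rfl⟩ := hx
          obtain ⟨f', m', -, rfl⟩ := hy
          refine AddSubgroup.subset_closure ⟨f * f', m + m', by simp, ?_⟩
          simp only [map_mul, Pi.add_apply, pow_add, Finset.prod_mul_distrib]
          ring
  have h1 : ∀ t, t ⊆ s → x ∈ S t := by
    intro t
    induction t using Finset.induction_on with
    | empty => exact fun _ => h0
    | insert i t hi ih =>
      intro hts
      have his : i ∈ s := hts (Finset.mem_insert_self _ _)
      have h2 := ih fun j hj => hts (Finset.mem_insert_of_mem hj)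
      rw [← pr_of_const hp (D i) (hDx i his)]
      suffices H : ∀ y ∈ S t, pr p (D i) y ∈ S (insert i t) from H x h2
      intro y hy
      induction hy using AddSubgroup.closure_induction with
      | zero => rw [map_zero]; exact zero_mem _
      | add a b _ _ ha hb => rw [map_add]; exact add_mem ha hb
      | neg a _ ha => rw [map_neg]; exact neg_mem ha
      | mem y hy =>
        obtain ⟨f, m, hm, rfl⟩ := hy
        set y := algebraMap F E f * ∏ j ∈ s, β j ^ m j with hy
        have h3 : D i y = m i * y := der_monom (p := p) (D i) (hF i) s β m i his (hDi i his) (hD i his) f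
        have h4 : ∀ q : ℕ, (dE (D i) ^ q) y = (m i : E) ^ q * y := by
          intro q
          induction q with
          | zero => simp
          | succ q ihq =>
            rw [pow_succ', Module.End.mul_apply, ihq, dE_apply, ← Nat.cast_pow,
              der_const_mul _ (by simp), h3]
            push_cast; ring
        rw [pr_apply, h4]
        by_cases hd : p ∣ m i
        · rw [(CharP.cast_eq_zero_iff E p _).2 hd, zero_pow (by have := hp.two_le; omega), zero_mul,
            sub_zero]
          refine AddSubgroup.subset_closure ⟨f, m, ?_, rfl⟩
          intro j hj
          rcases Finset.mem_insert.1 hj with rfl | hj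
          · exact hd
          · exact hm j hj
        · have h5 : (m i : E) ^ (p - 1) = 1 := by
            have h6 : ((m i : ZMod p)) ≠ 0 := by
              rwa [Ne, ZMod.natCast_eq_zero_iff]
            have h7 := ZMod.pow_card_sub_one_eq_one h6
            have h8 := congrArg (ZMod.castHom dvd_rfl E) h7
            simpa using h8
          rw [h5, one_mul, sub_self]; exact zero_mem _
  have h2 := h1 s subset_rfl
  have h3 : S s ≤ (algebraMap F E).range.toAddSubgroup := by
    rw [AddSubgroup.closure_le]
    rintro _ ⟨f, m, hm, rfl⟩
    change _ ∈ (algebraMap F E).range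
    refine mul_mem ⟨f, rfl⟩ (prod_mem fun j hj => ?_)
    obtain ⟨q, hq⟩ := hm j hj
    rw [hq, pow_mul, hβ]
    exact ⟨b j ^ q, map_pow _ _ _⟩
  exact h3 h2
end
end KM

set_option linter.unusedSectionVars false
namespace KM

open Finset

universe uF uE
variable {F : Type uF} {E : Type uE} [Field F] [Field E] [Algebra F E]

theorem exists_adapted {p : ℕ} (hp : p.Prime) [CharP E p] {r : ℕ} (b : Fin r → F) (β : Fin r → E)
    (hβ : ∀ i, β i ^ p = algebraMap F E (b i))
    (hgen : Algebra.adjoin F (Set.range β) = ⊤) :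
    ∃ (ι : Type uF) (_ : LinearOrder ι), Nonempty (Adapted p F E b ι) := by
  classical
  have := Fact.mk hp
  obtain ⟨I, hI, hImin⟩ := exists_min β hgen
  have hIalg : Algebra.adjoin F (β '' I) = ⊤ := by
    rw [← IntermediateField.adjoin_eq_top_iff_of_isAlgebraic]
    · exact hI
    · rintro _ ⟨i, -, rfl⟩
      refine IsIntegral.isAlgebraic (IsIntegral.of_pow hp.pos ?_)
      rw [hβ]; exact isIntegral_algebraMap
  choose Dd hDdF hDdi hDdj using fun i : I => exists_dual hp b β hβ I hI i.1 (hImin i.1 i.2)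
  let dE' := KaehlerDifferential.D ℤ E
  obtain ⟨κ, a, -, hspanW, hindW⟩ := exists_linearIndependent' E
    (fun f : F => dE' (algebraMap F E f))
  let va : κ → KaehlerDifferential ℤ E := (fun f : F => dE' (algebraMap F E f)) ∘ a
  let vb : I → KaehlerDifferential ℤ E := fun i => dE' (β i)
  have hW : ∀ f : F, dE' (algebraMap F E f) ∈ Submodule.span E (Set.range va) := by
    intro f; rw [hspanW]; exact Submodule.subset_span ⟨f, rfl⟩
  have hphia : ∀ (i : I) (z), z ∈ Submodule.span E (Set.range va) →
      (Dd i).liftKaehlerDifferential z = 0 := by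
    intro i z hz
    refine (Submodule.span_le (p := LinearMap.ker (Dd i).liftKaehlerDifferential)).2 ?_ hz
    rintro _ ⟨k, rfl⟩
    simp [va, dE', hDdF]
  have hβ0 : ∀ i : I, β i ≠ 0 := fun i h => hImin i.1 i.2 (by rw [h]; exact zero_mem _)
  have hsum : ∀ (g : I → E) (i : I), (Dd i).liftKaehlerDifferential (∑ j, g j • vb j) = g i * β i := by
    intro g i
    rw [map_sum, Finset.sum_eq_single i]
    · simp [vb, dE', hDdi]
    · intro j _ hji
      have : Dd i (β j) = 0 := hDdj i j.1 j.2 (fun h => hji (Subtype.ext h))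
      simp [vb, dE', this]
    · intro h; exact absurd (Finset.mem_univ _) h
  have hindb : LinearIndependent E vb := by
    rw [Fintype.linearIndependent_iff]
    intro g hg i
    have h1 := hsum g i
    rw [hg, map_zero] at h1
    exact (mul_eq_zero.1 h1.symm).resolve_right (hβ0 i)
  have hdisj : Disjoint (Submodule.span E (Set.range va)) (Submodule.span E (Set.range vb)) := by
    rw [Submodule.disjoint_def]
    intro z hza hzb
    obtain ⟨g, rfl⟩ := (Submodule.mem_span_range_iff_exists_fun E).1 hzb
    refine Finset.sum_eq_zero fun i _ => ?_
    have h1 := hsum g i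
    rw [hphia i _ hza] at h1
    rw [(mul_eq_zero.1 h1.symm).resolve_right (hβ0 i), zero_smul]
  let x : κ ⊕ I → E := Sum.elim (fun k => algebraMap F E (a k)) (fun i => β i)
  have hv : Sum.elim va vb = fun i => dE' (x i) := by
    ext i; rcases i with i | i <;> rfl
  have hind := hindW.sum_type hindb hdisj
  have hspan : ⊤ ≤ Submodule.span E (Set.range (Sum.elim va vb)) := by
    rw [← KaehlerDifferential.span_range_derivation ℤ E, Submodule.span_le]
    rintro _ ⟨y, rfl⟩
    have hy : y ∈ Algebra.adjoin F (β '' I) := by rw [hIalg]; trivial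
    change dE' y ∈ Submodule.span E (Set.range (Sum.elim va vb))
    induction hy using Algebra.adjoin_induction with
    | mem x hx =>
      obtain ⟨i, hi, rfl⟩ := hx
      exact Submodule.subset_span ⟨Sum.inr ⟨i, hi⟩, rfl⟩
    | algebraMap f =>
      refine Submodule.span_mono ?_ (hW f)
      rintro _ ⟨k, rfl⟩
      exact ⟨Sum.inl k, rfl⟩
    | add x y _ _ hx hy => rw [map_add]; exact add_mem hx hy
    | mul x y _ _ hx hy =>
      rw [Derivation.leibniz]
      exact add_mem (Submodule.smul_mem _ _ hy) (Submodule.smul_mem _ _ hx)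
  let B : Module.Basis (κ ⊕ I) E (KaehlerDifferential ℤ E) := Module.Basis.mk hind hspan
  have hB : ∀ i, B i = dE' (x i) := by
    intro i; rw [Module.Basis.mk_apply, hv]
  let D : κ ⊕ I → Derivation ℤ E E := fun i => (x i • B.coord i).compDer dE'
  have hD : ∀ i y, D i y = x i * B.repr (dE' y) i := fun i y => rfl
  have hDself : ∀ i, D i (x i) = x i := by
    intro i; rw [hD, ← hB]; simp
  have hDne : ∀ i j, i ≠ j → D i (x j) = 0 := by
    intro i j hij; rw [hD, ← hB]; simp [hij.symm]
  have hspan' : ⊤ ≤ Submodule.span E (Set.range fun i => dE' (x i)) := by rwa [← hv]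
  have hx0 : ∀ i, x i ≠ 0 := by
    intro i h
    have h1 := hind.ne_zero i
    rw [hv] at h1
    exact h1 (by simp only [h, map_zero])
  have hDx : ∀ i j, ∃ m : ℕ, D i (x j) = (m : E) * x j := by
    intro i j
    by_cases hij : i = j
    · subst hij; exact ⟨1, by simp [hDself]⟩
    · exact ⟨0, by simp [hDne i j hij]⟩
  have hDF : ∀ (t : I) (f : F), D (Sum.inr t) (algebraMap F E f) = 0 := by
    intro t f
    rw [hD]
    have : B.repr (dE' (algebraMap F E f)) (Sum.inr t) = 0 := by
      refine (Submodule.span_le (p := LinearMap.ker (B.coord (Sum.inr t)))).2 ?_ (hW f)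
      rintro _ ⟨k, rfl⟩
      have : va k = B (Sum.inl k) := by rw [hB]; rfl
      simp [this]
    rw [this, mul_zero]
  letI : LinearOrder κ := IsWellOrder.linearOrder WellOrderingRel
  letI lo : LinearOrder (κ ⊕ I) := LinearOrder.lift' (toLex : κ ⊕ I → κ ⊕ₗ I) toLex.injective
  let T : Finset (κ ⊕ I) := Finset.univ.image Sum.inr
  have hTmem : ∀ i : I, Sum.inr i ∈ T := fun i => Finset.mem_image_of_mem _ (Finset.mem_univ _)
  have hTnot : ∀ k : κ, Sum.inl k ∉ T := by
    intro k h; obtain ⟨i, -, h⟩ := Finset.mem_image.1 h; cases h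
  refine ⟨κ ⊕ I, lo, ⟨{
    T := T
    upper := ?_
    x := x
    c := Sum.elim a (fun _ => 0)
    D := D
    x_ne := hx0
    D_self := hDself
    D_ne := hDne
    comm := ?_
    pow := ?_
    x_c := ?_
    fin := ?_
    mem := ?_
    spanF := ?_ }⟩⟩
  · intro t ht j htj
    obtain ⟨i, -, rfl⟩ := Finset.mem_image.1 ht
    rcases j with k | j
    · exact absurd htj Sum.Lex.not_inr_lt_inl
    · exact hTmem j
  · intro i j y
    have h1 : ⁅D i, D j⁆ y = (0 : Derivation ℤ E E) y := by
      refine der_eq_of_span x hspan' _ _ (fun l => ?_) y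
      obtain ⟨m, hm⟩ := hDx i l
      obtain ⟨m', hm'⟩ := hDx j l
      rw [Derivation.commutator_apply, hm, hm', der_const_mul _ (by simp), der_const_mul _ (by simp),
        hm, hm']
      simp; ring
    rw [Derivation.commutator_apply] at h1
    exact sub_eq_zero.1 h1
  · intro i y
    rw [← derP_apply hp]
    refine der_eq_of_span x hspan' _ _ (fun l => ?_) y
    rw [derP_apply]
    by_cases hil : i = l
    · subst hil
      have : ∀ q : ℕ, (dE (D i) ^ q) (x i) = x i := by
        intro q
        induction q with
        | zero => rfl
        | succ q ih => rw [pow_succ, Module.End.mul_apply, dE_apply, hDself, ih]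
      rw [this, hDself]
    · rw [hDne i l hil, ← Nat.sub_add_cancel hp.one_lt.le, pow_succ, Module.End.mul_apply, dE_apply,
        hDne i l hil, map_zero]
  · intro i hi
    rcases i with k | i
    · rfl
    · exact absurd (hTmem i) hi
  · intro y
    refine ⟨(B.repr (dE' y)).support, fun i hi => ?_, ?_⟩
    · rw [hD, Finsupp.notMem_support_iff.1 hi, mul_zero]
    · conv_lhs => rw [← B.linearCombination_repr (KaehlerDifferential.D ℤ E y)]
      rw [Finsupp.linearCombination_apply, Finsupp.sum]
      refine Finset.sum_congr rfl fun i _ => ?_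
      rw [hD, hB, smul_smul]
      congr 1
      have := hx0 i
      field_simp
      rfl
  · intro y
    constructor
    · intro hy
      refine K3 hp (Finset.univ : Finset I) (fun i => b i) (fun i => β i) (fun i => hβ i)
        (fun i => D (Sum.inr i)) (fun i f => hDF i f) (fun i _ => hDself (Sum.inr i))
        (fun i _ j _ hji => hDne (Sum.inr i) (Sum.inr j) (by simpa using hji.symm)) y ?_
        (fun i _ => hy _ (hTmem i))
      have e : (fun i : I => β i) '' (Finset.univ : Finset I) = β '' I := by
        ext z; simp
      rw [e, hIalg]; trivial
    · rintro ⟨f, rfl⟩ t ht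
      obtain ⟨i, -, rfl⟩ := Finset.mem_image.1 ht
      exact hDF i f
  · intro z
    by_contra hz
    obtain ⟨f, hfz, hf⟩ := Submodule.exists_le_ker_of_notMem hz
    let δ : Derivation ℤ F F := f.compDer (KaehlerDifferential.D ℤ F)
    have hδ : ∀ y, δ y = f (KaehlerDifferential.D ℤ F y) := fun y => rfl
    obtain ⟨D', hD'⟩ := lemY hp b β hβ hgen δ fun i => by
      rw [hδ]
      exact hf (Submodule.subset_span (Or.inr ⟨i, rfl⟩))
    have h1 : ∀ y, δ y = 0 := by
      intro y
      apply (algebraMap F E).injective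
      rw [map_zero, ← hD', ← Derivation.liftKaehlerDifferential_comp_D D']
      refine (Submodule.span_le (p := LinearMap.ker D'.liftKaehlerDifferential)).2 ?_ (hW y)
      rintro _ ⟨k, rfl⟩
      have h2 : δ (a k) = 0 := by
        rw [hδ]
        exact hf (Submodule.subset_span (Or.inl ⟨Sum.inl k, hTnot k, rfl⟩))
      simp [va, dE', hD', h2]
    apply hfz
    have h3 : z ∈ Submodule.span F (Set.range (KaehlerDifferential.D ℤ F)) := by
      rw [KaehlerDifferential.span_range_derivation]; trivial
    refine (Submodule.span_le (p := LinearMap.ker f)).2 ?_ h3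
    rintro _ ⟨y, rfl⟩
    exact h1 y

end KM

set_option linter.unusedSectionVars false
namespace KM

open Finset

namespace DSys
universe uk
variable {k : Type uk} [Field k] {p : ℕ} [CharP k p] {ι : Type*} [LinearOrder ι]
  (X : DSys p k ι)

/-- The field of elements killed by the derivations outside `C`. -/
def constField (C : Finset ι) : Subfield k where
  carrier := {x | ∀ c, c ∉ C → X.D c x = 0}
  mul_mem' := by
    intro a b ha hb c hc
    rw [Derivation.leibniz, ha c hc, hb c hc]; simp
  one_mem' := by intro c _; simp
  add_mem' := by intro a b ha hb c hc; rw [map_add, ha c hc, hb c hc, add_zero]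
  zero_mem' := by intro c _; simp
  neg_mem' := by intro a ha c hc; rw [map_neg, ha c hc, neg_zero]
  inv_mem' := by intro a ha c hc; rw [Derivation.leibniz_inv, ha c hc, smul_zero]

/-- restricted derivation -/
def resD (C : Finset ι) (i : ι) : Derivation ℤ (X.constField C) (X.constField C) :=
  Derivation.mk' (AddMonoidHom.mk' (fun a : X.constField C => (⟨X.D i a, fun c hc => by
      rw [X.comm, a.2 c hc, map_zero]⟩ : X.constField C))
      (fun a b => Subtype.ext (by simp))).toIntLinearMap
    (fun a b => Subtype.ext (by simp))

lemma resD_coe (C : Finset ι) (i : ι) (a : X.constField C) :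
    ((X.resD C i a : X.constField C) : k) = X.D i a := rfl

lemma resD_pow (C : Finset ι) (i : ι) (q : ℕ) (a : X.constField C) :
    (((dE (X.resD C i) ^ q) a : X.constField C) : k) = (dE (X.D i) ^ q) a := by
  induction q with
  | zero => rfl
  | succ q ih => rw [pow_succ', pow_succ', Module.End.mul_apply, Module.End.mul_apply, dE_apply,
      dE_apply, resD_coe, ih]

/-- restricted system -/
def resSys (C : Finset ι) : DSys p (X.constField C) {i // i ∈ C} where
  D i := X.resD C i
  comm i j a := Subtype.ext (X.comm i j a)
  pow i a := Subtype.ext (by rw [resD_pow]; exact X.pow i a)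

lemma sg_map (C : Finset ι) (l : {i // i ∈ C}) (σ : Finset {i // i ∈ C}) :
    sg (l : ι) (σ.map (Function.Embedding.subtype _)) = sg l σ := by
  unfold sg
  congr 1
  rw [Finset.filter_map, Finset.card_map]
  rfl

lemma dd_map (C : Finset ι) (f : Finset ι → k) (g : Finset {i // i ∈ C} → X.constField C)
    (h : ∀ σ, f (σ.map (Function.Embedding.subtype _)) = g σ) (σ : Finset {i // i ∈ C}) :
    X.dd f (σ.map (Function.Embedding.subtype _)) = ((X.resSys C).dd g σ : X.constField C) := by
  classical
  simp only [dd, Finset.sum_map]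
  push_cast
  refine Finset.sum_congr rfl fun l _ => ?_
  have e : (σ.map (Function.Embedding.subtype _)).erase (Function.Embedding.subtype _ l)
      = (σ.erase l).map (Function.Embedding.subtype _) := (Finset.map_erase _ _ _).symm
  rw [e, h]
  change sg (l : ι) _ • _ = _
  rw [sg_map]
  rfl

theorem model_inf (hp : p.Prime) (C T : Finset ι) (hTC : T ⊆ C)
    (hT : ∀ t ∈ T, ∀ j, t < j → j ∈ T)
    (ω u v : Finset ι → k) (heq : ∀ σ, ω σ = u σ ^ p - u σ + X.dd v σ)
    (h1 : ∀ σ, ¬ Disjoint σ T → ω σ = 0) (h2 : ∀ σ, ∀ t ∈ T, X.D t (ω σ) = 0)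
    (hω0 : ∀ σ, ¬ σ ⊆ C → ω σ = 0) (hωD : ∀ σ, ∀ c, c ∉ C → X.D c (ω σ) = 0)
    (huD : ∀ σ, ∀ c, c ∉ C → X.D c (u σ) = 0) (hvD : ∀ σ, ∀ c, c ∉ C → X.D c (v σ) = 0) :
    ∃ u' v' : Finset ι → k, (∀ σ, ω σ = u' σ ^ p - u' σ + X.dd v' σ) ∧
      (∀ σ, ¬ Disjoint σ T → u' σ = 0) ∧ (∀ σ, ¬ Disjoint σ T → v' σ = 0) ∧
      (∀ σ, ∀ t ∈ T, X.D t (u' σ) = 0) ∧ (∀ σ, ∀ t ∈ T, X.D t (v' σ) = 0) ∧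
      (∀ σ, ¬ σ ⊆ C → u' σ = 0) ∧ (∀ σ, ¬ σ ⊆ C → v' σ = 0) := by
  classical
  let em : {i // i ∈ C} ↪ ι := Function.Embedding.subtype _
  have hdisj : ∀ σ : Finset {i // i ∈ C}, Disjoint σ (T.subtype (· ∈ C)) ↔ Disjoint (σ.map em) T := by
    intro σ
    rw [Finset.disjoint_left, Finset.disjoint_left]
    simp only [Finset.mem_subtype, Finset.mem_map]
    constructor
    · rintro h _ ⟨a, ha, rfl⟩; exact h ha
    · intro h a ha; exact h ⟨a, ha, rfl⟩
  have hch : CharP (X.constField C) p := inferInstance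
  let ω1 : Finset {i // i ∈ C} → X.constField C := fun σ => ⟨ω (σ.map em), hωD _⟩
  let u1 : Finset {i // i ∈ C} → X.constField C := fun σ => ⟨u (σ.map em), huD _⟩
  let v1 : Finset {i // i ∈ C} → X.constField C := fun σ => ⟨v (σ.map em), hvD _⟩
  obtain ⟨u2, v2, e2, a1, a2, a3, a4⟩ := (X.resSys C).model hp (T.subtype (· ∈ C))
    (fun t ht j htj => by
      rw [Finset.mem_subtype] at ht ⊢
      exact hT _ ht _ htj) ω1 u1 v1 (fun σ => by
      apply Subtype.ext
      have := X.dd_map C v v1 (fun _ => rfl) σ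
      push_cast
      rw [← this]
      exact heq _)
    (fun σ hσ => Subtype.ext (h1 _ (by rwa [← hdisj])))
    (fun σ t ht => Subtype.ext (h2 _ _ (by rwa [Finset.mem_subtype] at ht)))
  let ex : (Finset {i // i ∈ C} → X.constField C) → Finset ι → k := fun f σ =>
    if σ ⊆ C then (f (σ.subtype (· ∈ C)) : k) else 0
  have hmap : ∀ σ : Finset {i // i ∈ C}, (σ.map em).subtype (· ∈ C) = σ := by
    intro σ; ext a
    simp [em]
  have hsub : ∀ σ : Finset {i // i ∈ C}, σ.map em ⊆ C := by
    intro σ a ha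
    obtain ⟨a, -, rfl⟩ := Finset.mem_map.1 ha
    exact a.2
  have hex : ∀ f σ, ex f (σ.map em) = f σ := by
    intro f σ; simp only [ex, if_pos (hsub σ), hmap]
  have hback : ∀ σ, σ ⊆ C → ∃ σ' : Finset {i // i ∈ C}, σ'.map em = σ := by
    intro σ hσ
    refine ⟨σ.subtype (· ∈ C), ?_⟩
    rw [Finset.subtype_map]
    exact Finset.filter_true_of_mem fun a ha => hσ ha
  have hex0 : ∀ f σ, ¬ σ ⊆ C → ex f σ = 0 := by
    intro f σ hσ; simp only [ex, if_neg hσ]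
  have hexD : ∀ f σ c, c ∉ C → X.D c (ex f σ) = 0 := by
    intro f σ c hc
    by_cases hσ : σ ⊆ C
    · obtain ⟨σ, rfl⟩ := hback σ hσ
      rw [hex]; exact (f σ).2 c hc
    · rw [hex0 f σ hσ, map_zero]
  refine ⟨ex u2, ex v2, fun σ => ?_, fun σ hd => ?_, fun σ hd => ?_, fun σ t ht => ?_,
    fun σ t ht => ?_, hex0 u2, hex0 v2⟩
  · by_cases hσ : σ ⊆ C
    · obtain ⟨σ, rfl⟩ := hback σ hσ
      rw [hex, X.dd_map C (ex v2) v2 (hex v2)]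
      exact congrArg Subtype.val (e2 σ)
    · rw [hω0 σ hσ, hex0 u2 σ hσ, zero_pow hp.ne_zero, sub_zero, zero_add]
      symm
      refine Finset.sum_eq_zero fun l hl => ?_
      by_cases hlC : l ∈ C
      · rw [hex0, map_zero, smul_zero]
        intro h
        apply hσ
        rw [← Finset.insert_erase hl]
        exact Finset.insert_subset hlC h
      · rw [hexD _ _ l hlC, smul_zero]
  · by_cases hσ : σ ⊆ C
    · obtain ⟨σ, rfl⟩ := hback σ hσ
      rw [hex, a1 σ (by rwa [hdisj])]; rfl
    · exact hex0 _ _ hσ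
  · by_cases hσ : σ ⊆ C
    · obtain ⟨σ, rfl⟩ := hback σ hσ
      rw [hex, a2 σ (by rwa [hdisj])]; rfl
    · exact hex0 _ _ hσ
  · by_cases hσ : σ ⊆ C
    · obtain ⟨σ, rfl⟩ := hback σ hσ
      rw [hex]
      exact congrArg Subtype.val (a3 σ ⟨t, hTC ht⟩ (by simpa using ht))
    · rw [hex0 _ _ hσ, map_zero]
  · by_cases hσ : σ ⊆ C
    · obtain ⟨σ, rfl⟩ := hback σ hσ
      rw [hex]
      exact congrArg Subtype.val (a4 σ ⟨t, hTC ht⟩ (by simpa using ht))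
    · rw [hex0 _ _ hσ, map_zero]

end DSys
end KM

set_option linter.unusedSectionVars false
noncomputable section
namespace KM

open Finset

section general
variable {K : Type*} [Field K]

lemma df_ind (N : Submodule K (DF K)) (h1 : 1 ∈ N) (hm : ∀ y, ∀ w ∈ N, dForm K y * w ∈ N)
    (w : DF K) : w ∈ N := by
  have hι : ∀ θ : KaehlerDifferential ℤ K, ∀ w ∈ N, ExteriorAlgebra.ι K θ * w ∈ N := by
    intro θ w hw
    have hθ : θ ∈ Submodule.span K (Set.range (KaehlerDifferential.D ℤ K)) := by
      rw [KaehlerDifferential.span_range_derivation]; trivial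
    induction hθ using Submodule.span_induction with
    | mem x hx => obtain ⟨y, rfl⟩ := hx; exact hm y w hw
    | zero => rw [map_zero, zero_mul]; exact zero_mem _
    | add x y _ _ hx hy => rw [map_add, add_mul]; exact add_mem hx hy
    | smul a x _ hx => rw [map_smul, smul_mul_assoc]; exact Submodule.smul_mem _ _ hx
  have h : ∀ z w : DF K, w ∈ N → z * w ∈ N := by
    intro z
    induction z using ExteriorAlgebra.induction with
    | algebraMap r => intro w hw; rw [← Algebra.smul_def]; exact Submodule.smul_mem _ _ hw
    | ι x => exact hι x
    | mul a b ha hb => intro w hw; rw [mul_assoc]; exact ha _ (hb _ hw)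
    | add a b ha hb => intro w hw; rw [add_mul]; exact add_mem (ha _ hw) (hb _ hw)
  simpa using h w 1 h1

lemma range_ι_eq (s : Set (KaehlerDifferential ℤ K)) (hs : Submodule.span K s = ⊤) :
    LinearMap.range (ExteriorAlgebra.ι K : KaehlerDifferential ℤ K →ₗ[K] DF K) =
      Submodule.span K ((ExteriorAlgebra.ι K) '' s) := by
  rw [← Submodule.map_span, hs, Submodule.map_top]

lemma span_dlog : Submodule.span K
    (Set.range fun a : K => a⁻¹ • KaehlerDifferential.D ℤ K a) = ⊤ := by
  rw [eq_top_iff, ← KaehlerDifferential.span_range_derivation ℤ K, Submodule.span_le]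
  rintro _ ⟨y, rfl⟩
  by_cases hy : y = 0
  · rw [hy, map_zero]; exact zero_mem _
  · have : KaehlerDifferential.D ℤ K y = y • (y⁻¹ • KaehlerDifferential.D ℤ K y) := by
      rw [smul_smul, mul_inv_cancel₀ hy, one_smul]
    rw [this]
    exact Submodule.smul_mem _ _ (Submodule.subset_span ⟨y, rfl⟩)

lemma omegaPow_span (n : ℕ) : omegaPow K n =
    Submodule.span K (Set.range fun x : Fin n → K => logForm K x) := by
  rw [omegaPow, range_ι_eq _ span_dlog, Submodule.span_pow]
  congr 1
  ext w
  rw [Set.mem_pow]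
  constructor
  · rintro ⟨f, rfl⟩
    choose g hg using fun i => (f i).2
    choose a ha using fun i => (hg i).1
    refine ⟨a, ?_⟩
    simp only [logForm, dLog]
    congr 2
    ext i
    rw [← (hg i).2, ← ha i]
  · rintro ⟨x, rfl⟩
    exact ⟨fun i => ⟨dLog K (x i), ⟨_, ⟨x i, rfl⟩, rfl⟩⟩, rfl⟩

lemma logForm_mem (n : ℕ) (x : Fin n → K) : logForm K x ∈ omegaPow K n := by
  rw [omegaPow_span]; exact Submodule.subset_span ⟨x, rfl⟩

lemma ι_mul_mem {n : ℕ} (θ : KaehlerDifferential ℤ K) {w : DF K} (hw : w ∈ omegaPow K n) :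
    ExteriorAlgebra.ι K θ * w ∈ omegaPow K (n + 1) := by
  rw [omegaPow, pow_succ']
  exact Submodule.mul_mem_mul ⟨θ, rfl⟩ hw

lemma d_dForm_mul {p : ℕ} (S : DiffStr p K) (a : K) (w : DF K) :
    S.d (dForm K a * w) = - (dForm K a * S.d w) := by
  have h1 := S.d_d (a • w)
  rw [S.d_smul, map_add, S.d_smul, S.d_d, smul_zero, add_zero] at h1
  exact eq_neg_of_add_eq_zero_left h1

end general

namespace DSys
variable {k : Type*} [Field k] {p : ℕ} [CharP k p] {ι : Type*} [LinearOrder ι]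
  (X : DSys p k ι)

lemma act_act (θ : ι → k) (f : Finset ι → k) (σ : Finset ι) : act θ (act θ f) σ = 0 := by
  classical
  simp only [act, Finset.mul_sum, Finset.smul_sum]
  rw [← alt_sum σ (fun l j => if l < j then θ l * (θ j * (f ((σ.erase l).erase j))) else 0)]
  refine Finset.sum_congr rfl fun l _ => Finset.sum_congr rfl fun j hj => ?_
  rw [mul_smul_comm]
  congr 2
  rcases lt_or_gt_of_ne (Finset.ne_of_mem_erase hj) with h | h
  · rw [if_neg (lt_asymm h), if_pos h, zero_add, Finset.erase_right_comm]; ring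
  · rw [if_neg (lt_asymm h), if_pos h, add_zero]

lemma dd_mul (a : k) (g : Finset ι → k) (σ : Finset ι) :
    X.dd (fun σ => a * g σ) σ = act (fun l => X.D l a) g σ + a * X.dd g σ := by
  simp only [dd, act, Finset.mul_sum]
  rw [← Finset.sum_add_distrib]
  refine Finset.sum_congr rfl fun l _ => ?_
  rw [Derivation.leibniz, mul_smul_comm, ← smul_add, smul_eq_mul, smul_eq_mul]
  congr 1; ring

lemma dd_act (y : k) (f : Finset ι → k) (σ : Finset ι) :
    X.dd (act (fun l => X.D l y) f) σ = - act (fun l => X.D l y) (X.dd f) σ := by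
  have e : act (fun l => X.D l y) f = fun σ => X.dd (fun σ => y * f σ) σ - y * X.dd f σ := by
    ext σ; rw [dd_mul]; ring
  rw [e, dd_sub]
  simp only
  have := X.dd_dd (fun σ => y * f σ) σ
  rw [this, dd_mul, dd_dd, mul_zero, add_zero, zero_sub]

end DSys

namespace Adapted
variable {p : ℕ} {F E : Type*} [Field F] [Field E] [Algebra F E] {r : ℕ} {b : Fin r → F}
    {ι : Type*} [LinearOrder ι] [CharP E p] (A : Adapted p F E b ι)

/-- The system of derivations. -/
def sys : DSys p E ι := ⟨A.D, A.comm, A.pow⟩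

/-- The coordinates of a one-form. -/
def co (θ : KaehlerDifferential ℤ E) : ι → E := fun l => (A.D l).liftKaehlerDifferential θ

lemma co_D (y : E) : A.co (KaehlerDifferential.D ℤ E y) = fun l => A.D l y := by
  ext l; simp [co]

/-- Action of one-forms on coefficient systems. -/
def actL : KaehlerDifferential ℤ E →ₗ[E] Module.End E (Finset ι → E) :=
  LinearMap.mk₂ E (fun θ f => DSys.act (A.co θ) f)
    (fun θ θ' f => by
      ext σ; simp only [DSys.act, co, map_add, add_mul, smul_add, Finset.sum_add_distrib,
        Pi.add_apply])
    (fun a θ f => by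
      ext σ
      simp only [DSys.act, co, map_smul, Pi.smul_apply, smul_eq_mul, Finset.mul_sum]
      refine Finset.sum_congr rfl fun l _ => ?_
      rw [mul_smul_comm, mul_assoc])
    (fun θ f g => by
      ext σ; simp only [DSys.act, Pi.add_apply, mul_add, smul_add, Finset.sum_add_distrib])
    (fun a θ f => by
      ext σ
      simp only [DSys.act, Pi.smul_apply, smul_eq_mul, Finset.mul_sum]
      refine Finset.sum_congr rfl fun l _ => ?_
      rw [mul_smul_comm, mul_left_comm])

/-- The action of all forms. -/
def actA : DF E →ₐ[E] Module.End E (Finset ι → E) :=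
  ExteriorAlgebra.lift E ⟨A.actL, fun θ => by
    ext f σ
    exact DSys.act_act _ _ _⟩

/-- Coefficients of a form. -/
def coef : DF E →ₗ[E] (Finset ι → E) :=
  (LinearMap.applyₗ (Pi.single (M := fun _ : Finset ι => E) ∅ (1 : E)) :
    Module.End E (Finset ι → E) →ₗ[E] (Finset ι → E)) ∘ₗ A.actA.toLinearMap

lemma coef_one : A.coef 1 = Pi.single ∅ 1 := by
  simp [coef]

lemma coef_ι_mul (θ : KaehlerDifferential ℤ E) (w : DF E) :
    A.coef (ExteriorAlgebra.ι E θ * w) = DSys.act (A.co θ) (A.coef w) := by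
  simp only [coef, LinearMap.comp_apply, AlgHom.toLinearMap_apply, map_mul,
    LinearMap.applyₗ_apply_apply, Module.End.mul_apply]
  rw [actA, ExteriorAlgebra.lift_ι_apply]
  rfl

lemma coef_dForm_mul (y : E) (w : DF E) :
    A.coef (dForm E y * w) = DSys.act (fun l => A.D l y) (A.coef w) := by
  rw [dForm, coef_ι_mul, co_D]

lemma coef_d (S : DiffStr p E) (w : DF E) (σ : Finset ι) :
    A.coef (S.d w) σ = A.sys.dd (A.coef w) σ := by
  let N : Submodule E (DF E) :=
    { carrier := {w | ∀ σ, A.coef (S.d w) σ = A.sys.dd (A.coef w) σ}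
      add_mem' := by
        intro w w' h h' σ
        rw [map_add, map_add, map_add]
        have := congrFun (A.sys.dd_add (A.coef w) (A.coef w')) σ
        change _ = A.sys.dd (fun σ => A.coef w σ + A.coef w' σ) σ
        rw [this, Pi.add_apply, h, h']
      zero_mem' := by
        intro σ
        simp [DSys.dd]
      smul_mem' := by
        intro a w h σ
        rw [S.d_smul, map_add, map_smul, map_smul, coef_dForm_mul]
        change _ = A.sys.dd (fun σ => a * A.coef w σ) σ
        rw [DSys.dd_mul, ← h σ]
        rfl }
  refine df_ind N ?_ ?_ w σ
  · intro σ
    rw [S.d_one, map_zero, coef_one]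
    symm
    refine Finset.sum_eq_zero fun l _ => ?_
    have : A.sys.D l ((Pi.single ∅ 1 : Finset ι → E) (σ.erase l)) = 0 := by
      by_cases h : σ.erase l = ∅
      · rw [h]; simp
      · rw [Pi.single_eq_of_ne h, map_zero]
    rw [this, smul_zero]
  · intro y w h σ
    have h' : A.coef (S.d w) = A.sys.dd (A.coef w) := funext h
    rw [d_dForm_mul, map_neg, coef_dForm_mul, coef_dForm_mul, h']
    exact (A.sys.dd_act y (A.coef w) σ).symm

/-- finiteness of support -/
lemma coef_fin (w : DF E) : ∃ C : Finset ι, (∀ σ, ¬ σ ⊆ C → A.coef w σ = 0) ∧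
    ∀ σ c, c ∉ C → A.D c (A.coef w σ) = 0 := by
  classical
  let N : Submodule E (DF E) :=
    { carrier := {w | ∃ C : Finset ι, (∀ σ, ¬ σ ⊆ C → A.coef w σ = 0) ∧
        ∀ σ c, c ∉ C → A.D c (A.coef w σ) = 0}
      add_mem' := by
        rintro w w' ⟨C, h1, h2⟩ ⟨C', h1', h2'⟩
        refine ⟨C ∪ C', fun σ hσ => ?_, fun σ c hc => ?_⟩
        · rw [map_add, Pi.add_apply, h1 _ fun h => hσ (h.trans Finset.subset_union_left),
            h1' _ fun h => hσ (h.trans Finset.subset_union_right), add_zero]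
        · rw [Finset.notMem_union] at hc
          rw [map_add, Pi.add_apply, map_add, h2 _ _ hc.1, h2' _ _ hc.2, add_zero]
      zero_mem' := ⟨∅, by simp, by simp⟩
      smul_mem' := by
        rintro a w ⟨C, h1, h2⟩
        obtain ⟨s, hs, -⟩ := A.fin a
        refine ⟨C ∪ s, fun σ hσ => ?_, fun σ c hc => ?_⟩
        · rw [map_smul, Pi.smul_apply, h1 _ fun h => hσ (h.trans Finset.subset_union_left),
            smul_zero]
        · rw [Finset.notMem_union] at hc
          rw [map_smul, Pi.smul_apply, smul_eq_mul, Derivation.leibniz, h2 _ _ hc.1, hs _ hc.2]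
          simp }
  refine df_ind N ⟨∅, ?_, ?_⟩ ?_ w
  · intro σ hσ
    rw [coef_one, Pi.single_eq_of_ne]
    rintro rfl; exact hσ subset_rfl
  · intro σ c _
    rw [coef_one]
    by_cases h : σ = ∅
    · rw [h]; simp
    · rw [Pi.single_eq_of_ne h, map_zero]
  · rintro y w ⟨C, h1, h2⟩
    obtain ⟨s, hs, -⟩ := A.fin y
    refine ⟨C ∪ s, fun σ hσ => ?_, fun σ c hc => ?_⟩
    · rw [coef_dForm_mul]
      refine Finset.sum_eq_zero fun l hl => ?_
      by_cases hls : l ∈ s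
      · rw [h1, mul_zero, smul_zero]
        intro h
        apply hσ
        rw [← Finset.insert_erase hl]
        exact Finset.insert_subset (Finset.mem_union_right _ hls) (h.trans Finset.subset_union_left)
      · simp only [hs l hls, zero_mul, smul_zero]
    · rw [coef_dForm_mul]
      rw [Finset.notMem_union] at hc
      simp only [DSys.act, map_sum, map_zsmul]
      refine Finset.sum_eq_zero fun l hl => ?_
      rw [Derivation.leibniz, h2 _ _ hc.1, A.comm, hs c hc.2, map_zero]
      simp

end Adapted
end KM
end

set_option linter.unusedSectionVars false
noncomputable section
namespace KM

open Finset

section general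
variable {K : Type*} [Field K] {ι : Type*} [LinearOrder ι]

/-- Products of logarithmic forms along a list. -/
def eL (c : ι → K) (L : List ι) : DF K := (L.map fun i => dLog K (c i)).prod

lemma eL_nil (c : ι → K) : eL c [] = 1 := rfl

lemma eL_cons (c : ι → K) (i : ι) (L : List ι) : eL c (i :: L) = dLog K (c i) * eL c L := by
  simp [eL]

lemma eL_logForm (c : ι → K) (L : List ι) :
    eL c L = logForm K (fun i : Fin L.length => c (L.get i)) := by
  rw [eL, logForm]
  congr 1
  apply List.ext_get
  · simp
  · intro n h1 h2; simp

lemma eL_ofFn (c : ι → K) {n : ℕ} (j : Fin n → ι) :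
    logForm K (fun i => c (j i)) = eL c (List.ofFn j) := by
  rw [eL, logForm, List.map_ofFn]
  rfl

lemma eL_mem (c : ι → K) (L : List ι) : eL c L ∈ omegaPow K L.length := by
  rw [eL_logForm]; exact logForm_mem _ _

lemma dLog_sq (a : K) : dLog K a * dLog K a = 0 := ExteriorAlgebra.ι_sq_zero _

lemma ι_anti (θ θ' : KaehlerDifferential ℤ K) :
    ExteriorAlgebra.ι K θ * ExteriorAlgebra.ι K θ' =
      - (ExteriorAlgebra.ι K θ' * ExteriorAlgebra.ι K θ) := by
  have h := ExteriorAlgebra.ι_add_mul_swap (R := K) θ θ'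
  exact eq_neg_of_add_eq_zero_left h

lemma eL_insert (c : ι → K) (i : ι) (L : List ι) (hL : L.Pairwise (· < ·)) :
    dLog K (c i) * eL c L = 0 ∨ ∃ L' : List ι, L'.Pairwise (· < ·) ∧ L'.length = L.length + 1 ∧
      (∀ j ∈ L', j = i ∨ j ∈ L) ∧
      (dLog K (c i) * eL c L = eL c L' ∨ dLog K (c i) * eL c L = - eL c L') := by
  induction L with
  | nil => right; exact ⟨[i], by simp, by simp, by simp, Or.inl (by rw [eL_cons])⟩
  | cons a L ih =>
    rw [List.pairwise_cons] at hL
    rcases lt_trichotomy i a with h | h | h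
    · right
      refine ⟨i :: a :: L, ?_, by simp, by simp, Or.inl (by rw [eL_cons c i])⟩
      rw [List.pairwise_cons, List.pairwise_cons]
      refine ⟨?_, hL⟩
      intro j hj
      rcases List.mem_cons.1 hj with rfl | hj
      · exact h
      · exact h.trans (hL.1 j hj)
    · left
      rw [eL_cons, h, ← mul_assoc, dLog_sq, zero_mul]
    · have e : dLog K (c i) * eL c (a :: L) = - (dLog K (c a) * (dLog K (c i) * eL c L)) := by
        rw [eL_cons, ← mul_assoc, ← mul_assoc, dLog, dLog, ι_anti, neg_mul]
      rcases ih hL.2 with h0 | ⟨L', h1, h2, h3, h4⟩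
      · left; rw [e, h0, mul_zero, neg_zero]
      · right
        refine ⟨a :: L', ?_, by simp [h2], ?_, ?_⟩
        · rw [List.pairwise_cons]
          refine ⟨fun j hj => ?_, h1⟩
          rcases h3 j hj with rfl | hj
          · exact h
          · exact hL.1 j hj
        · intro j hj
          rcases List.mem_cons.1 hj with rfl | hj
          · right; simp
          · rcases h3 j hj with rfl | hj
            · left; rfl
            · right; simp [hj]
        · rw [e, eL_cons]
          rcases h4 with h4 | h4
          · right; rw [h4]
          · left; rw [h4, mul_neg, neg_neg]

/-- Ordered products. -/
def eS (c : ι → K) (σ : Finset ι) : DF K := eL c (σ.sort (· ≤ ·))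

lemma eS_mem (c : ι → K) (σ : Finset ι) : eS c σ ∈ omegaPow K σ.card := by
  have := eL_mem c (σ.sort (· ≤ ·))
  rwa [Finset.length_sort] at this

lemma eL_eS (c : ι → K) (L : List ι) (hL : L.Pairwise (· < ·)) : eL c L = eS c L.toFinset := by
  rw [eS]
  congr 1
  symm
  rw [List.toFinset_sort]
  · exact hL.imp le_of_lt
  · exact hL.imp ne_of_lt

lemma eS_logForm (c : ι → K) (σ : Finset ι) :
    ∃ x : Fin σ.card → K, eS c σ = logForm K x := by
  have h := eL_logForm c (σ.sort (· ≤ ·))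
  have hl := Finset.length_sort (s := σ) (· ≤ ·)
  rw [eS, h, hl.symm]
  exact ⟨_, rfl⟩

end general

namespace Adapted
variable {p : ℕ} {F E : Type*} [Field F] [Field E] [Algebra F E] {r : ℕ} {b : Fin r → F}
    {ι : Type*} [LinearOrder ι] [CharP E p] (A : Adapted p F E b ι)

lemma co_dlog (i l : ι) : A.co ((A.x i)⁻¹ • KaehlerDifferential.D ℤ E (A.x i)) l
    = if l = i then 1 else 0 := by
  have : A.co ((A.x i)⁻¹ • KaehlerDifferential.D ℤ E (A.x i)) l = (A.x i)⁻¹ * A.D l (A.x i) := by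
    simp [co]
  rw [this]
  split_ifs with h
  · rw [h, A.D_self, inv_mul_cancel₀ (A.x_ne i)]
  · rw [A.D_ne _ _ h, mul_zero]

lemma coef_dLog_mul (i : ι) (w : DF E) (σ : Finset ι) :
    A.coef (dLog E (A.x i) * w) σ = if i ∈ σ then sg i σ • A.coef w (σ.erase i) else 0 := by
  rw [dLog, coef_ι_mul]
  simp only [DSys.act, co_dlog, ite_mul, one_mul, zero_mul, smul_ite, smul_zero]
  rw [Finset.sum_ite_eq']

lemma coef_eL_pow (hp : p.Prime) (L : List ι) (σ : Finset ι) :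
    (A.coef (eL A.x L) σ) ^ p = A.coef (eL A.x L) σ := by
  have := Fact.mk hp
  induction L generalizing σ with
  | nil =>
    rw [eL_nil, coef_one]
    by_cases h : σ = ∅
    · rw [h]; simp
    · rw [Pi.single_eq_of_ne h, zero_pow hp.ne_zero]
  | cons i L ih =>
    rw [eL_cons, coef_dLog_mul]
    split_ifs
    · rw [zsmul_eq_mul, mul_pow, ih, ← frobenius_def p ((sg i σ : ℤ) : E), map_intCast]
    · exact zero_pow hp.ne_zero

lemma coef_eL (L : List ι) (hL : L.Pairwise (· < ·)) :
    A.coef (eL A.x L) = Pi.single L.toFinset 1 := by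
  induction L with
  | nil => rw [eL_nil, coef_one]; rfl
  | cons i L ih =>
    rw [List.pairwise_cons] at hL
    ext σ
    have hi : i ∉ L.toFinset := by
      rw [List.mem_toFinset]; intro h; exact lt_irrefl _ (hL.1 i h)
    rw [eL_cons, coef_dLog_mul, ih hL.2, List.toFinset_cons]
    by_cases h : σ = insert i L.toFinset
    · subst h
      rw [if_pos (Finset.mem_insert_self _ _), Finset.erase_insert hi, Pi.single_eq_same,
        Pi.single_eq_same]
      have : sg i (insert i L.toFinset) = 1 := by
        unfold sg
        rw [Finset.filter_false_of_mem]
        · simp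
        · intro j hj
          rcases Finset.mem_insert.1 hj with rfl | hj
          · exact lt_irrefl _
          · exact lt_asymm (hL.1 j (List.mem_toFinset.1 hj))
      rw [this, one_smul]
    · rw [Pi.single_eq_of_ne h]
      split_ifs with h'
      · rw [Pi.single_eq_of_ne, smul_zero]
        intro h2
        apply h
        rw [← h2, Finset.insert_erase h']
      · rfl

lemma coef_eS (σ : Finset ι) : A.coef (eS A.x σ) = Pi.single σ 1 := by
  rw [eS, coef_eL, Finset.sort_toFinset]
  exact Finset.sortedLT_sort σ |>.pairwise

lemma span_E : Submodule.span E
    (Set.range fun i => (A.x i)⁻¹ • KaehlerDifferential.D ℤ E (A.x i)) = ⊤ := by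
  rw [eq_top_iff, ← KaehlerDifferential.span_range_derivation ℤ E, Submodule.span_le]
  rintro _ ⟨y, rfl⟩
  obtain ⟨s, -, h⟩ := A.fin y
  rw [h]
  exact Submodule.sum_mem _ fun i _ => Submodule.smul_mem _ _ (Submodule.subset_span ⟨i, rfl⟩)

lemma omegaPow_spanE (n : ℕ) : omegaPow E n =
    Submodule.span E (Set.range fun j : Fin n → ι => logForm E (fun i => A.x (j i))) := by
  rw [omegaPow, range_ι_eq _ A.span_E, Submodule.span_pow]
  congr 1
  ext w
  rw [Set.mem_pow]
  constructor
  · rintro ⟨f, rfl⟩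
    choose g hg using fun i => (f i).2
    choose a ha using fun i => (hg i).1
    refine ⟨a, ?_⟩
    simp only [logForm, dLog]
    congr 2
    ext i
    rw [← (hg i).2, ← ha i]
  · rintro ⟨x, rfl⟩
    exact ⟨fun i => ⟨dLog E (A.x (x i)), ⟨_, ⟨x i, rfl⟩, rfl⟩⟩, rfl⟩

lemma coef_sp (hp : p.Prime) (S : DiffStr p E) (n : ℕ) (u : DF E) (hu : u ∈ omegaPow E n) :
    ∃ η : DF E, ∀ σ, A.coef (S.sp u) σ = (A.coef u σ) ^ p + A.sys.dd (A.coef η) σ := by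
  have := Fact.mk hp
  rw [omegaPow_spanE A] at hu
  induction hu using Submodule.closure_induction with
  | zero => exact ⟨0, fun σ => by simp [DSys.dd, hp.ne_zero]⟩
  | add u u' _ _ h h' =>
    obtain ⟨η, h⟩ := h
    obtain ⟨η', h'⟩ := h'
    refine ⟨η + η', fun σ => ?_⟩
    have e := congrFun (A.sys.dd_add (A.coef η) (A.coef η')) σ
    rw [map_add, map_add, map_add, map_add, Pi.add_apply, Pi.add_apply, h, h', add_pow_char]
    change _ = _ + A.sys.dd (fun σ => A.coef η σ + A.coef η' σ) σ
    rw [e]; ring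
  | smul_mem a w hw =>
    obtain ⟨j, rfl⟩ := hw
    obtain ⟨η, -, h⟩ := S.sp_log n a (fun i => A.x (j i))
    refine ⟨η, fun σ => ?_⟩
    simp only
    rw [h, map_add, Pi.add_apply, coef_d, map_smul, map_smul, Pi.smul_apply, Pi.smul_apply,
      smul_eq_mul, smul_eq_mul, mul_pow, eL_ofFn, coef_eL_pow A hp]

end Adapted
end KM
end

set_option linter.unusedSectionVars false
noncomputable section
namespace KM

open Finset

section rel
variable {p : ℕ} {K : Type*} [Field K] (S : DiffStr p K)

lemma hRel_as {n : ℕ} {w : DF K} (hw : w ∈ omegaPow K n) : S.sp w - w ∈ hRel S n :=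
  AddSubgroup.mem_sup_left ⟨w, hw, rfl⟩

lemma hRel_d {n : ℕ} {w : DF K} (hw : w ∈ omegaPred K n) : S.d w ∈ hRel S n :=
  AddSubgroup.mem_sup_right ⟨w, hw, rfl⟩

lemma hRel_log {n : ℕ} (a : K) (x : Fin n → K) :
    (a ^ p - a) • logForm K x ∈ hRel S n := by
  obtain ⟨η, hη, h⟩ := S.sp_log n a x
  have h1 : S.sp (a • logForm K x) - a • logForm K x ∈ hRel S n :=
    hRel_as S (Submodule.smul_mem _ _ (logForm_mem n x))
  have e : (a ^ p - a) • logForm K x = (S.sp (a • logForm K x) - a • logForm K x) - S.d η := by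
    rw [h, sub_smul]; abel
  rw [e]
  exact sub_mem h1 (hRel_d S hη)

lemma hRel_grade {n : ℕ} {w : DF K} (hw : w ∈ hRel S n) : ∃ u ∈ omegaPow K n,
    ∃ v ∈ omegaPred K n, w = S.sp u - u + S.d v := by
  obtain ⟨a, ⟨u, hu, rfl⟩, c, ⟨v, hv, rfl⟩, rfl⟩ := AddSubgroup.mem_sup.1 hw
  exact ⟨u, hu, v, hv, rfl⟩

lemma dForm_mul_mem (a : K) {n : ℕ} {w : DF K} (hw : w ∈ omegaPred K n) :
    dForm K a * w ∈ omegaPow K n := by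
  cases n with
  | zero => rw [(Submodule.mem_bot K).1 hw, mul_zero]; exact zero_mem _
  | succ n => exact ι_mul_mem _ hw

lemma d_mem {n : ℕ} {w : DF K} (hw : w ∈ omegaPred K n) : S.d w ∈ omegaPow K n := by
  cases n with
  | zero => rw [(Submodule.mem_bot K).1 hw, map_zero]; exact zero_mem _
  | succ n => exact S.d_grade n w hw

end rel

section res
variable {p : ℕ} {F E : Type*} [Field F] [Field E] [Algebra F E] {SF : DiffStr p F}
  {SE : DiffStr p E} (R : DiffRes p F E SF SE)

lemma res_dLog (a : F) : R.res (dLog F a) = dLog E (algebraMap F E a) := by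
  have h1 : dLog F a = a⁻¹ • dForm F a := by rw [dLog, dForm, map_smul]
  have h2 : dLog E (algebraMap F E a) = (algebraMap F E a)⁻¹ • dForm E (algebraMap F E a) := by
    rw [dLog, dForm, map_smul]
  rw [h1, h2, R.res_smul, R.res_dForm, map_inv₀]

lemma res_prod (L : List (DF F)) : R.res L.prod = (L.map R.res).prod := by
  induction L with
  | nil => exact R.res_one
  | cons a L ih => rw [List.prod_cons, R.res_mul, ih, List.map_cons, List.prod_cons]

lemma res_logForm {n : ℕ} (x : Fin n → F) :
    R.res (logForm F x) = logForm E (fun i => algebraMap F E (x i)) := by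
  rw [logForm, res_prod, logForm, List.map_ofFn]
  congr 2
  ext i
  exact res_dLog R _

lemma res_eL {ι : Type*} (c : ι → F) (L : List ι) :
    R.res (eL c L) = eL (fun i => algebraMap F E (c i)) L := by
  rw [eL, res_prod, eL, List.map_map]
  congr 2
  ext i
  exact res_dLog R _

lemma res_pred {n : ℕ} {w : DF F} (hw : w ∈ omegaPred F n) : R.res w ∈ omegaPred E n := by
  cases n with
  | zero => rw [(Submodule.mem_bot F).1 hw, map_zero]; exact zero_mem _
  | succ n => exact R.res_grade n w hw

lemma res_hRel {n : ℕ} {w : DF F} (hw : w ∈ hRel SF n) : R.res w ∈ hRel SE n := by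
  obtain ⟨u, hu, v, hv, rfl⟩ := hRel_grade SF hw
  rw [map_add, R.res_d]
  refine add_mem ?_ (hRel_d SE (res_pred R hv))
  clear hw
  rw [omegaPow_span] at hu
  induction hu using Submodule.closure_induction with
  | zero => simp
  | add u u' _ _ h h' =>
    have e : R.res (SF.sp (u + u') - (u + u')) = R.res (SF.sp u - u) + R.res (SF.sp u' - u') := by
      simp only [map_add, map_sub]; abel
    rw [e]
    exact add_mem h h'
  | smul_mem a w hw =>
    obtain ⟨x, rfl⟩ := hw
    obtain ⟨η, hη, h⟩ := SF.sp_log n a x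
    have e : R.res (SF.sp (a • logForm F x) - a • logForm F x) =
        ((algebraMap F E a) ^ p - algebraMap F E a) • logForm E (fun i => algebraMap F E (x i))
          + SE.d (R.res η) := by
      rw [h, map_sub, map_add, R.res_smul, R.res_smul, R.res_d, res_logForm, map_pow, sub_smul]
      abel
    simp only
    rw [e]
    exact add_mem (hRel_log SE _ _) (hRel_d SE (res_pred R hη))

lemma res_db [CharP E p] (b : F) (β : E) (hβ : β ^ p = algebraMap F E b) :
    R.res (dForm F b) = 0 := by
  rw [R.res_dForm, ← hβ, dForm, Derivation.leibniz_pow]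
  rw [← Nat.cast_smul_eq_nsmul E]
  simp

end res

namespace Adapted
variable {p : ℕ} {F E : Type*} [Field F] [Field E] [Algebra F E] {r : ℕ} {b : Fin r → F}
    {ι : Type*} [LinearOrder ι] [CharP E p] (A : Adapted p F E b ι) {SF : DiffStr p F}
  {SE : DiffStr p E} (R : DiffRes p F E SF SE)

lemma D_alg {t : ι} (ht : t ∈ A.T) (a : F) : A.D t (algebraMap F E a) = 0 :=
  (A.mem _).2 ⟨a, rfl⟩ t ht

lemma res_coef (w : DF F) : (∀ σ, ¬ Disjoint σ A.T → A.coef (R.res w) σ = 0) ∧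
    ∀ σ, ∀ t ∈ A.T, A.D t (A.coef (R.res w) σ) = 0 := by
  let N : Submodule F (DF F) :=
    { carrier := {w | (∀ σ, ¬ Disjoint σ A.T → A.coef (R.res w) σ = 0) ∧
        ∀ σ, ∀ t ∈ A.T, A.D t (A.coef (R.res w) σ) = 0}
      add_mem' := by
        rintro w w' ⟨h1, h2⟩ ⟨h1', h2'⟩
        refine ⟨fun σ hσ => ?_, fun σ t ht => ?_⟩
        · rw [map_add, map_add, Pi.add_apply, h1 σ hσ, h1' σ hσ, add_zero]
        · rw [map_add, map_add, Pi.add_apply, map_add, h2 σ t ht, h2' σ t ht, add_zero]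
      zero_mem' := by constructor <;> simp
      smul_mem' := by
        rintro a w ⟨h1, h2⟩
        refine ⟨fun σ hσ => ?_, fun σ t ht => ?_⟩
        · rw [R.res_smul, map_smul, Pi.smul_apply, h1 σ hσ, smul_zero]
        · rw [R.res_smul, map_smul, Pi.smul_apply, smul_eq_mul, Derivation.leibniz, h2 σ t ht,
            A.D_alg ht]
          simp }
  refine df_ind N ⟨?_, ?_⟩ ?_ w
  · intro σ hσ
    rw [R.res_one, coef_one, Pi.single_eq_of_ne]
    rintro rfl; exact hσ (Finset.disjoint_empty_left _)
  · intro σ t _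
    rw [R.res_one, coef_one]
    by_cases h : σ = ∅
    · rw [h]; simp
    · rw [Pi.single_eq_of_ne h, map_zero]
  · rintro y w ⟨h1, h2⟩
    refine ⟨fun σ hσ => ?_, fun σ t ht => ?_⟩
    · rw [R.res_mul, R.res_dForm, coef_dForm_mul]
      refine Finset.sum_eq_zero fun l hl => ?_
      by_cases hlT : l ∈ A.T
      · simp only [A.D_alg hlT, zero_mul, smul_zero]
      · rw [h1, mul_zero, smul_zero]
        intro h
        apply hσ
        rw [← Finset.insert_erase hl, Finset.disjoint_insert_left]
        exact ⟨hlT, h⟩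
    · rw [R.res_mul, R.res_dForm, coef_dForm_mul]
      simp only [DSys.act, map_sum, map_zsmul]
      refine Finset.sum_eq_zero fun l hl => ?_
      rw [Derivation.leibniz, h2 _ _ ht, A.comm, A.D_alg ht, map_zero]
      simp

lemma res_eS (σ : Finset ι) (hσ : Disjoint σ A.T) : R.res (eS A.c σ) = eS A.x σ := by
  rw [eS, res_eL, eS, eL, eL]
  congr 1
  refine List.map_congr_left fun i hi => ?_
  rw [A.x_c i]
  exact Finset.disjoint_left.1 hσ ((Finset.mem_sort _).1 hi)

/-- The part generated by the `db i`. -/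
def Mdb (_ : Adapted p F E b ι) (n : ℕ) : Submodule F (DF F) where
  carrier := {w | ∃ η : Fin r → DF F, (∀ i, η i ∈ omegaPred F n) ∧ w = ∑ i, dForm F (b i) * η i}
  add_mem' := by
    rintro _ _ ⟨η, h, rfl⟩ ⟨η', h', rfl⟩
    refine ⟨fun i => η i + η' i, fun i => add_mem (h i) (h' i), ?_⟩
    simp only [mul_add, Finset.sum_add_distrib]
  zero_mem' := ⟨fun _ => 0, fun _ => zero_mem _, by simp⟩
  smul_mem' := by
    rintro a _ ⟨η, h, rfl⟩
    refine ⟨fun i => a • η i, fun i => Submodule.smul_mem _ _ (h i), ?_⟩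
    simp only [mul_smul_comm, Finset.smul_sum]

lemma Mdb_single (n : ℕ) (i : Fin r) (w : DF F) (hw : w ∈ omegaPred F n) :
    dForm F (b i) * w ∈ A.Mdb n := by
  classical
  refine ⟨Pi.single i w, fun j => ?_, ?_⟩
  · by_cases h : j = i
    · subst h; simpa using hw
    · rw [Pi.single_eq_of_ne h]; exact zero_mem _
  · rw [Finset.sum_eq_single i]
    · simp
    · intro j _ h; rw [Pi.single_eq_of_ne h, mul_zero]
    · simp

lemma Mdb_ι_mul (n : ℕ) (θ : KaehlerDifferential ℤ F) (w : DF F) (hw : w ∈ A.Mdb n) :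
    ExteriorAlgebra.ι F θ * w ∈ A.Mdb (n + 1) := by
  obtain ⟨η, h, rfl⟩ := hw
  rw [Finset.mul_sum]
  refine Submodule.sum_mem _ fun i _ => ?_
  rw [← mul_assoc, dForm, ι_anti, neg_mul, mul_assoc]
  refine Submodule.neg_mem _ (A.Mdb_single (n + 1) i _ ?_)
  have := h i
  cases n with
  | zero => rw [(Submodule.mem_bot F).1 this, mul_zero]; exact zero_mem _
  | succ n => exact ι_mul_mem _ this

/-- index set -/
def Sn (n : ℕ) : Set (Finset ι) := {σ | σ.card = n ∧ Disjoint σ A.T}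

lemma c_ne (i : ι) (hi : i ∉ A.T) : A.c i ≠ 0 := by
  intro h
  have := A.x_c i hi
  rw [h, map_zero] at this
  exact A.x_ne i this

lemma normal (n : ℕ) : omegaPow F n ≤ Submodule.span F (eS A.c '' A.Sn n) ⊔ A.Mdb n := by
  induction n with
  | zero =>
    rw [omegaPow, pow_zero, Submodule.one_le]
    refine Submodule.mem_sup_left (Submodule.subset_span ⟨∅, ⟨rfl, Finset.disjoint_empty_left _⟩, ?_⟩)
    simp [eS, eL]
  | succ n ih =>
    rw [omegaPow, pow_succ', Submodule.mul_le]
    rintro _ ⟨θ, rfl⟩ w hw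
    have hw' := ih hw
    have hθ := A.spanF θ
    induction hθ using Submodule.span_induction with
    | zero => rw [map_zero, zero_mul]; exact zero_mem _
    | add x y _ _ hx hy => rw [map_add, add_mul]; exact add_mem hx hy
    | smul a x _ hx => rw [map_smul, smul_mul_assoc]; exact Submodule.smul_mem _ _ hx
    | mem x hx =>
      rcases hx with ⟨i, hi, rfl⟩ | ⟨i, rfl⟩
      · obtain ⟨y, hy, m, hm, rfl⟩ := Submodule.mem_sup.1 hw'
        rw [mul_add]
        refine add_mem (Submodule.mem_sup_left ?_) (Submodule.mem_sup_right (A.Mdb_ι_mul n _ _ hm))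
        clear hw hw'
        induction hy using Submodule.span_induction with
        | zero => rw [mul_zero]; exact zero_mem _
        | add x y _ _ hx hy => rw [mul_add]; exact add_mem hx hy
        | smul a x _ hx => rw [mul_smul_comm]; exact Submodule.smul_mem _ _ hx
        | mem w hw =>
          obtain ⟨σ, ⟨h1, h2⟩, rfl⟩ := hw
          have e : ExteriorAlgebra.ι F (KaehlerDifferential.D ℤ F (A.c i)) =
              A.c i • dLog F (A.c i) := by
            rw [dLog, map_smul, smul_smul, mul_inv_cancel₀ (A.c_ne i hi), one_smul]
          simp only
          rw [e, smul_mul_assoc]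
          refine Submodule.smul_mem _ _ ?_
          rcases eL_insert A.c i (σ.sort (· ≤ ·)) (Finset.sortedLT_sort σ).pairwise with
            h | ⟨L', k1, k2, k3, k4⟩
          · rw [eS, h]; exact zero_mem _
          · have hm : eL A.c L' ∈ Submodule.span F (eS A.c '' A.Sn (n + 1)) := by
              refine Submodule.subset_span ⟨L'.toFinset, ⟨?_, ?_⟩, (eL_eS _ _ k1).symm⟩
              · rw [List.toFinset_card_of_nodup (k1.imp ne_of_lt), k2, Finset.length_sort, h1]
              · rw [Finset.disjoint_left]
                intro j hj
                rcases k3 j (List.mem_toFinset.1 hj) with rfl | hj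
                · exact hi
                · exact Finset.disjoint_left.1 h2 ((Finset.mem_sort _).1 hj)
            rcases k4 with k4 | k4
            · rw [eS, k4]; exact hm
            · rw [eS, k4]; exact Submodule.neg_mem _ hm
      · exact Submodule.mem_sup_right (A.Mdb_single (n + 1) i w hw)

lemma mem_Mdb (hb : ∀ i, R.res (dForm F (b i)) = 0) (n : ℕ) (z : DF F) (hz : z ∈ omegaPow F n)
    (h0 : ∀ σ, σ.card = n → A.coef (R.res z) σ = 0) : z ∈ A.Mdb n := by
  obtain ⟨y, hy, m, hm, rfl⟩ := Submodule.mem_sup.1 (A.normal n hz)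
  have hrm : R.res m = 0 := by
    obtain ⟨η, -, rfl⟩ := hm
    rw [map_sum]
    exact Finset.sum_eq_zero fun i _ => by rw [R.res_mul, hb, zero_mul]
  rw [Finsupp.mem_span_image_iff_linearCombination] at hy
  obtain ⟨l, hl, rfl⟩ := hy
  rw [Finsupp.mem_supported] at hl
  have hc : ∀ τ, A.coef (R.res (Finsupp.linearCombination F (eS A.c) l)) τ
      = algebraMap F E (l τ) := by
    intro τ
    rw [Finsupp.linearCombination_apply, Finsupp.sum, map_sum, map_sum, Finset.sum_apply]
    rw [Finset.sum_eq_single τ]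
    · by_cases h : τ ∈ l.support
      · rw [R.res_smul, res_eS A R _ (hl h).2, map_smul, coef_eS, Pi.smul_apply, Pi.single_eq_same,
          smul_eq_mul, mul_one]
      · rw [Finsupp.notMem_support_iff.1 h]; simp
    · intro σ hσ hne
      rw [R.res_smul, res_eS A R _ (hl hσ).2, map_smul, coef_eS, Pi.smul_apply,
        Pi.single_eq_of_ne hne.symm, smul_zero]
    · intro h
      rw [Finsupp.notMem_support_iff.1 h]; simp
  have hl0 : l = 0 := by
    ext τ
    by_contra h
    have hτ : τ ∈ l.support := Finsupp.mem_support_iff.2 h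
    have := h0 τ (hl hτ).1
    rw [map_add, hrm, add_zero, hc] at this
    exact h ((map_eq_zero _).1 this)
  rw [hl0, map_zero, zero_add]
  exact hm

end Adapted
end KM
end

set_option linter.unusedSectionVars false
noncomputable section
namespace KM

open Finset

namespace Adapted
variable {p : ℕ} {F E : Type*} [Field F] [Field E] [Algebra F E] {r : ℕ} {b : Fin r → F}
    {ι : Type*} [LinearOrder ι] [CharP E p] (A : Adapted p F E b ι) {SF : DiffStr p F}
  {SE : DiffStr p E} (R : DiffRes p F E SF SE)

lemma coef_sum (s : Finset (Finset ι)) (hs : ∀ σ ∈ s, Disjoint σ A.T) (f : Finset ι → F)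
    (τ : Finset ι) : A.coef (R.res (∑ σ ∈ s, f σ • eS A.c σ)) τ =
      if τ ∈ s then algebraMap F E (f τ) else 0 := by
  rw [map_sum, map_sum, Finset.sum_apply]
  rw [← Finset.sum_ite_eq s τ (fun σ => algebraMap F E (f σ))]
  refine Finset.sum_congr rfl fun σ hσ => ?_
  rw [R.res_smul, res_eS A R _ (hs σ hσ), map_smul, coef_eS, Pi.smul_apply, smul_eq_mul]
  by_cases h : τ = σ
  · rw [if_pos h, h, Pi.single_eq_same, mul_one]
  · rw [if_neg h, Pi.single_eq_of_ne h, mul_zero]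

theorem forward (A : Adapted p F E b ι) (hp : p.Prime) (hb : ∀ i, R.res (dForm F (b i)) = 0) (n : ℕ) (ω : DF F)
    (hω : ω ∈ omegaPow F n) (h : R.res ω ∈ hRel SE n) :
    ∃ η : Fin r → DF F, (∀ i, η i ∈ omegaPred F n) ∧
      ω - ∑ i, dForm F (b i) * η i ∈ hRel SF n := by
  classical
  obtain ⟨u, hu, v, hv, e⟩ := hRel_grade SE h
  obtain ⟨η, hη⟩ := A.coef_sp hp SE n u hu
  obtain ⟨C1, c1, c1'⟩ := A.coef_fin (R.res ω)
  obtain ⟨C2, c2, c2'⟩ := A.coef_fin u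
  obtain ⟨C3, c3, c3'⟩ := A.coef_fin (η + v)
  let C := A.T ∪ (C1 ∪ (C2 ∪ C3))
  have hC1 : C1 ⊆ C := fun i hi => by simp [C, hi]
  have hC2 : C2 ⊆ C := fun i hi => by simp [C, hi]
  have hC3 : C3 ⊆ C := fun i hi => by simp [C, hi]
  have heq : ∀ σ, A.coef (R.res ω) σ =
      A.coef u σ ^ p - A.coef u σ + A.sys.dd (A.coef (η + v)) σ := by
    intro σ
    have e2 := congrFun (A.sys.dd_add (A.coef η) (A.coef v)) σ
    rw [e, map_add, map_sub, Pi.add_apply, Pi.sub_apply, hη, coef_d, map_add]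
    change _ = _ + A.sys.dd (fun σ => A.coef η σ + A.coef v σ) σ
    rw [e2]; ring
  obtain ⟨u', v', heq', hu1, hv1, hu2, hv2, hu3, hv3⟩ :=
    A.sys.model_inf hp C A.T Finset.subset_union_left A.upper _ _ _ heq
      (A.res_coef R ω).1 (A.res_coef R ω).2 (fun σ hσ => c1 σ fun h => hσ (h.trans hC1))
      (fun σ c hc => c1' σ c fun h => hc (hC1 h)) (fun σ c hc => c2' σ c fun h => hc (hC2 h))
      (fun σ c hc => c3' σ c fun h => hc (hC3 h))
  choose uF huF using fun σ => (A.mem (u' σ)).1 (hu2 σ)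
  choose vF hvF using fun σ => (A.mem (v' σ)).1 (hv2 σ)
  let s1 := C.powerset.filter fun σ => σ.card = n ∧ Disjoint σ A.T
  let s2 := C.powerset.filter fun σ => σ.card + 1 = n ∧ Disjoint σ A.T
  let U : DF F := ∑ σ ∈ s1, (uF σ ^ p - uF σ) • eS A.c σ
  let V : DF F := ∑ σ ∈ s2, vF σ • eS A.c σ
  have hU : U ∈ hRel SF n := by
    refine AddSubgroup.sum_mem _ fun σ hσ => ?_
    obtain ⟨x, hx⟩ := eS_logForm A.c σ
    have hn : σ.card = n := (Finset.mem_filter.1 hσ).2.1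
    rw [hx]
    subst hn
    exact hRel_log SF _ _
  have hU' : U ∈ omegaPow F n := by
    refine Submodule.sum_mem _ fun σ hσ => Submodule.smul_mem _ _ ?_
    have hn : σ.card = n := (Finset.mem_filter.1 hσ).2.1
    rw [← hn]
    exact eS_mem _ _
  have hV : V ∈ omegaPred F n := by
    refine Submodule.sum_mem _ fun σ hσ => Submodule.smul_mem _ _ ?_
    have hn : σ.card + 1 = n := (Finset.mem_filter.1 hσ).2.1
    rw [← hn]
    exact eS_mem _ _
  have hz : ω - (U + SF.d V) ∈ A.Mdb n := by
    refine A.mem_Mdb R hb n _ (sub_mem hω (add_mem hU' (d_mem SF hV))) fun τ hτ => ?_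
    have k1 : A.coef (R.res U) τ = u' τ ^ p - u' τ := by
      rw [coef_sum A R _ (fun σ hσ => (Finset.mem_filter.1 hσ).2.2), map_sub, map_pow, huF]
      split_ifs with hm
      · rfl
      · have : u' τ = 0 := by
          by_cases hs : τ ⊆ C
          · refine hu1 τ fun hd => hm ?_
            exact Finset.mem_filter.2 ⟨Finset.mem_powerset.2 hs, hτ, hd⟩
          · exact hu3 τ hs
        rw [this, zero_pow hp.ne_zero, sub_zero]
    have k2 : A.coef (R.res (SF.d V)) τ = A.sys.dd v' τ := by
      rw [R.res_d, coef_d]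
      refine Finset.sum_congr rfl fun l hl => ?_
      congr 2
      rw [coef_sum A R _ (fun σ hσ => (Finset.mem_filter.1 hσ).2.2), hvF]
      split_ifs with hm
      · rfl
      · symm
        by_cases hs : τ.erase l ⊆ C
        · refine hv1 _ fun hd => hm ?_
          refine Finset.mem_filter.2 ⟨Finset.mem_powerset.2 hs, ?_, hd⟩
          rw [Finset.card_erase_add_one hl, hτ]
        · exact hv3 _ hs
    rw [map_sub, map_add, map_sub, map_add, Pi.sub_apply, Pi.add_apply, k1, k2, heq', sub_self]
  obtain ⟨ζ, hζ, eζ⟩ := hz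
  refine ⟨ζ, hζ, ?_⟩
  rw [← eζ, sub_sub_cancel]
  exact add_mem hU (hRel_d SF hV)

end Adapted

universe uF uE

theorem main (p : ℕ) (hp : p.Prime) (F : Type uF) (E : Type uE) [Field F] [Field E] [Algebra F E]
    [CharP F p] [CharP E p]
    (SF : DiffStr p F) (SE : DiffStr p E) (R : DiffRes p F E SF SE)
    (r : ℕ) (b : Fin r → F) (β : Fin r → E)
    (hβ : ∀ i, β i ^ p = algebraMap F E (b i))
    (hgen : Algebra.adjoin F (Set.range β) = ⊤)
    (n : ℕ) (ω : DF F) (hω : ω ∈ omegaPow F n) :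
    (R.res ω ∈ hRel SE n ↔ ∃ η : Fin r → DF F, (∀ i, η i ∈ omegaPred F n) ∧
        ω - ∑ i, dForm F (b i) * η i ∈ hRel SF n) ∧
    (R.res ω ∈ hRel SE n ↔ ∃ η : Fin r → DF F, (∀ i, η i ∈ omegaPred F n) ∧
        ω - ∑ i, b i • SF.d (η i) ∈ hRel SF n) := by
  have hb : ∀ i, R.res (dForm F (b i)) = 0 := fun i => res_db R (b i) (β i) (hβ i)
  have h1 : R.res ω ∈ hRel SE n ↔ ∃ η : Fin r → DF F, (∀ i, η i ∈ omegaPred F n) ∧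
        ω - ∑ i, dForm F (b i) * η i ∈ hRel SF n := by
    constructor
    · intro h
      obtain ⟨ι, _, ⟨A⟩⟩ := exists_adapted hp b β hβ hgen
      exact Adapted.forward R A hp hb n ω hω h
    · rintro ⟨η, -, h⟩
      have h2 := res_hRel R h
      rw [map_sub, map_sum, Finset.sum_eq_zero, sub_zero] at h2
      · exact h2
      · intro i _
        rw [R.res_mul, hb, zero_mul]
  refine ⟨h1, h1.trans ?_⟩
  have key : ∀ η : Fin r → DF F, (∀ i, η i ∈ omegaPred F n) →
      ((ω - ∑ i, dForm F (b i) * η i ∈ hRel SF n) ↔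
        ω - ∑ i, b i • SF.d (- η i) ∈ hRel SF n) := by
    intro η hη
    have e : ω - ∑ i, b i • SF.d (- η i) = (ω - ∑ i, dForm F (b i) * η i)
        + SF.d (∑ i, b i • η i) := by
      rw [map_sum]
      simp only [SF.d_smul, map_neg, smul_neg, Finset.sum_neg_distrib, Finset.sum_add_distrib]
      abel
    have hd : SF.d (∑ i, b i • η i) ∈ hRel SF n :=
      hRel_d SF (Submodule.sum_mem _ fun i _ => Submodule.smul_mem _ _ (hη i))
    rw [e, AddSubgroup.add_mem_cancel_right _ hd]
  constructor
  · rintro ⟨η, hη, h⟩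
    exact ⟨fun i => - η i, fun i => neg_mem (hη i), (key η hη).1 h⟩
  · rintro ⟨η, hη, h⟩
    refine ⟨fun i => - η i, fun i => neg_mem (hη i), (key _ fun i => neg_mem (hη i)).2 ?_⟩
    simpa only [neg_neg] using h

end KM
end

/-- **Theorem 3.4.** For `b₁,…,b_r ∈ F` and `E := F(b₁^{1/p},…,b_r^{1/p})`, the kernel
`H_p^{n+1}(E/F)` equals `Σᵢ` (image of `dbᵢ ∧ Ω_F^{n-1}` in `H_p^{n+1}(F)`), which also
equals `Σᵢ` (image of `bᵢ·d(Ω_F^{n-1})`). -/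
theorem hKernel_multiple_exponent_one
    (p : ℕ) (hp : p.Prime) (F E : Type*) [Field F] [Field E] [Algebra F E]
    [CharP F p] [CharP E p]
    (SF : DiffStr p F) (SE : DiffStr p E) (R : DiffRes p F E SF SE)
    (r : ℕ) (b : Fin r → F) (β : Fin r → E)
    (hβ : ∀ i, β i ^ p = algebraMap F E (b i))
    (hgen : Algebra.adjoin F (Set.range β) = ⊤)
    (n : ℕ) (ω : DF F) (hω : ω ∈ omegaPow F n) :
    (R.res ω ∈ hRel SE n ↔ ∃ η : Fin r → DF F, (∀ i, η i ∈ omegaPred F n) ∧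
        ω - ∑ i, dForm F (b i) * η i ∈ hRel SF n) ∧
    (R.res ω ∈ hRel SE n ↔ ∃ η : Fin r → DF F, (∀ i, η i ∈ omegaPred F n) ∧
        ω - ∑ i, b i • SF.d (η i) ∈ hRel SF n) := by
  exact KM.main p hp F E SF SE R r b β hβ hgen n ω hω
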